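/- arXiv:1011.5200 — 3 statements merged into one kernel-verified Lean document; each statement's English description precedes it below -/
import Mathlib

section
/- For every number of characters c ≥ 1 and every constant γ > 0 there exist constants a > 0 and C > 0 (depending only on c and γ) such that the following holds. Let Σ be a finite alphabet, let m = 2^b, let S ⊆ Σ^c be a set of n keys with m ≥ n^{1−1/(2c)}, let q ∈ Σ^c \ S be a query key, and let F : (ZMod 2)^b → (ZMod 2)^b be an arbitrary function. Hash by a random simple tabulation hash function h into m bins, let X_q = |{x ∈ S : h(x) = F(h(q))}| be the number of keys of S hashing into the bin F(h(q)) chosen as a function of h(q), and let μ = n/m. Then for every real δ with 0 < δ ≤ 1, Pr[|X_q − μ| > δ·μ] ≤ 2·exp(−a·δ²·μ) + C·m^{−γ}. -/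
open Finset

/-- Simple tabulation hashing: the hash of a key `x : Fin c → A` under tables
`T : Fin c → A → (Fin b → ZMod 2)` is the bitwise xor (coordinatewise sum in `ZMod 2`)
of the table entries `T i (x i)`. -/
def tabHash {c b : ℕ} {A : Type} (T : Fin c → A → (Fin b → ZMod 2)) (x : Fin c → A) :
    Fin b → ZMod 2 :=
  ∑ i, T i (x i)

/-- Probability, over a uniformly random choice of all tables, that the predicate `P`
holds of the resulting simple tabulation hash function. -/
noncomputable def tabPr (c b : ℕ) (A : Type)
    (P : (Fin c → A → (Fin b → ZMod 2)) → Prop) : ℝ :=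
  (Nat.card {T : Fin c → A → (Fin b → ZMod 2) // P T} : ℝ) /
    (Nat.card (Fin c → A → (Fin b → ZMod 2)) : ℝ)

section helpers

attribute [local instance] Classical.propDecidable

variable {c : ℕ} {A V : Type} [AddCommGroup V]

/-- generic hash -/
def gH (T : Fin c → A → V) (x : Fin c → A) : V := ∑ i, T i (x i)

/-- shift one table entry -/
noncomputable def eSh (i : Fin c) (a : A) (v : V) : Fin c → A → V :=
  fun j y => if j = i ∧ y = a then v else 0

theorem gH_shift (T : Fin c → A → V) (i : Fin c) (a : A) (v : V) (x : Fin c → A) :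
    gH (T + eSh i a v) x = gH T x + if x i = a then v else 0 := by
  unfold gH eSh
  simp only [Pi.add_apply, Finset.sum_add_distrib]
  congr 1
  rw [Finset.sum_eq_single i]
  · simp
  · intro j _ hj; simp [hj]
  · simp

theorem sum_avg [Fintype A] [Fintype V] (g : (Fin c → A → V) → ℝ) (i : Fin c) (a : A) :
    (Fintype.card V : ℝ) * ∑ T, g T = ∑ T, ∑ v, g (T + eSh i a v) := by
  rw [Finset.sum_comm]
  have : ∀ v : V, ∑ T, g (T + eSh i a v) = ∑ T, g T := fun v =>
    Fintype.sum_equiv (Equiv.addRight (eSh i a v)) _ _ (fun T => rfl)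
  simp [this]

/-- peelable lists -/
def Peel : List (Fin c → A) → Prop
  | [] => True
  | x :: l => (∃ i, ∀ y ∈ l, y i ≠ x i) ∧ Peel l

theorem peel_prob [Fintype A] [Fintype V] (v : V) (l : List (Fin c → A)) (hl : Peel l) :
    (Fintype.card V : ℝ) ^ l.length * ∑ T : Fin c → A → V, (if ∀ x ∈ l, gH T x = v then (1:ℝ) else 0)
      = Fintype.card (Fin c → A → V) := by
  induction l with
  | nil => simp
  | cons x l ih =>
    obtain ⟨⟨i, hi⟩, hp⟩ := hl
    rw [← ih hp, List.length_cons, pow_succ, mul_assoc, sum_avg _ i (x i)]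
    congr 1
    apply Finset.sum_congr rfl
    intro T _
    have h1 : ∀ u : V, (∀ y ∈ x :: l, gH (T + eSh i (x i) u) y = v) ↔
        (u = v - gH T x ∧ ∀ y ∈ l, gH T y = v) := by
      intro u
      simp only [List.mem_cons, forall_eq_or_imp, gH_shift, if_true]
      refine and_congr ?_ ?_
      · rw [eq_sub_iff_add_eq, add_comm]
      · refine forall₂_congr ?_
        intro y hy
        simp [hi y hy]
    simp only [h1]
    by_cases h : ∀ y ∈ l, gH T y = v
    · simp only [eq_true h, and_true, if_true]
      simp
    · simp [h]

theorem exists_peel (D : Finset (Fin c → A)) (k : ℕ) (hD : k ^ c < D.card) :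
    ∀ j ≤ k + 1, ∃ l : List (Fin c → A), l.length = j ∧ Peel l ∧ ∀ x ∈ l, x ∈ D := by
  intro j
  induction j with
  | zero => intro _; exact ⟨[], rfl, trivial, by simp⟩
  | succ j ih =>
    intro hj
    obtain ⟨l, hl, hp, hm⟩ := ih (by omega)
    by_contra! hcon
    have hsub : D ⊆ Fintype.piFinset (fun i => (l.map (fun y => y i)).toFinset) := by
      intro x hx
      rw [Fintype.mem_piFinset]
      intro i
      by_contra hn
      simp only [List.mem_toFinset, List.mem_map, not_exists, not_and] at hn
      obtain ⟨z, hz, hzD⟩ := hcon (x :: l) (by simp [hl]) ⟨⟨i, fun y hy => hn y hy⟩, hp⟩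
      rcases List.mem_cons.1 hz with rfl | hz
      · exact hzD hx
      · exact hzD (hm z hz)
    have h1 := Finset.card_le_card hsub
    rw [Fintype.card_piFinset] at h1
    have h2 : ∏ i : Fin c, ((l.map (fun y => y i)).toFinset).card ≤ ∏ i : Fin c, k := by
      apply Finset.prod_le_prod' 
      intro i _
      refine (List.toFinset_card_le _).trans ?_
      simp; omega
    simp at h2
    omega

theorem bad_bound [Fintype A] [Fintype V] (G : Finset (Fin c → A)) (k : ℕ) :
    ∑ T : Fin c → A → V, (if ∃ v, k ^ c < (G.filter (fun x => gH T x = v)).card then (1:ℝ) else 0)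
      ≤ Fintype.card (Fin c → A → V) * (Fintype.card V * ((G.card : ℝ) / Fintype.card V) ^ (k+1)) := by
  have hV : (0:ℝ) < Fintype.card V := by exact_mod_cast Fintype.card_pos
  have key : ∀ T : Fin c → A → V,
      (if ∃ v, k ^ c < (G.filter (fun x => gH T x = v)).card then (1:ℝ) else 0) ≤
      ∑ v : V, ∑ w ∈ Fintype.piFinset (fun _ : Fin (k+1) => G),
        if Peel (List.ofFn w) then (if ∀ x ∈ List.ofFn w, gH T x = v then (1:ℝ) else 0) else 0 := by
    intro T
    have hnn : ∀ (v : V) (w : Fin (k+1) → Fin c → A), (0:ℝ) ≤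
      if Peel (List.ofFn w) then (if ∀ x ∈ List.ofFn w, gH T x = v then (1:ℝ) else 0) else 0 := by
      intro v w; split_ifs <;> norm_num
    split_ifs with h
    · obtain ⟨v, hv⟩ := h
      obtain ⟨l, hl, hp, hm⟩ := exists_peel _ k hv (k+1) le_rfl
      obtain ⟨w, rfl⟩ : ∃ w : Fin (k+1) → Fin c → A, l = List.ofFn w := by
        rw [← hl]
        exact ⟨l.get, (List.ofFn_get l).symm⟩
      refine le_trans ?_ (Finset.single_le_sum (fun v _ => Finset.sum_nonneg (fun w _ => hnn v w)) (Finset.mem_univ v))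
      refine le_trans ?_ (Finset.single_le_sum (fun w _ => hnn v w) (a := w) ?_)
      · rw [if_pos hp, if_pos]
        intro x hx
        exact (Finset.mem_filter.1 (hm x hx)).2
      · rw [Fintype.mem_piFinset]
        intro i
        exact (Finset.mem_filter.1 (hm (w i) (List.mem_ofFn.2 ⟨i, rfl⟩))).1
    · exact Finset.sum_nonneg fun v _ => Finset.sum_nonneg (fun w _ => hnn v w)
  refine (Finset.sum_le_sum (fun T _ => key T)).trans ?_
  rw [Finset.sum_comm]
  have h2 : ∀ v : V, ∑ T : Fin c → A → V, ∑ w ∈ Fintype.piFinset (fun _ : Fin (k+1) => G),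
        (if Peel (List.ofFn w) then (if ∀ x ∈ List.ofFn w, gH T x = v then (1:ℝ) else 0) else 0)
      ≤ Fintype.card (Fin c → A → V) * ((G.card : ℝ) / Fintype.card V) ^ (k+1) := by
    intro v
    rw [Finset.sum_comm]
    have h3 : ∀ w ∈ Fintype.piFinset (fun _ : Fin (k+1) => G), ∑ T : Fin c → A → V, 
        (if Peel (List.ofFn w) then (if ∀ x ∈ List.ofFn w, gH T x = v then (1:ℝ) else 0) else 0)
        ≤ Fintype.card (Fin c → A → V) / (Fintype.card V : ℝ) ^ (k+1) := by
      intro w _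
      split_ifs with hp
      · have := peel_prob v _ hp
        rw [List.length_ofFn] at this
        rw [← this, mul_comm, mul_div_assoc, div_self (by positivity), mul_one]
      · simp; positivity
    refine (Finset.sum_le_sum h3).trans ?_
    rw [Finset.sum_const, Fintype.card_piFinset]
    simp only [Finset.prod_const, Finset.card_univ, Fintype.card_fin, nsmul_eq_mul]
    push_cast
    rw [div_pow]
    apply le_of_eq
    ring
  refine (Finset.sum_le_sum (fun v _ => h2 v)).trans ?_
  simp only [Finset.sum_const, Finset.card_univ, nsmul_eq_mul]
  apply le_of_eq
  ring

theorem exists_group (hc : 1 ≤ c) (S : Finset (Fin c → A)) (q : Fin c → A) (hq : q ∉ S) (hS : S.Nonempty)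
    (t : ℝ) (ht : 0 < t) (htS : (2:ℝ) ^ c * (S.card : ℝ) ^ (c-1) ≤ t ^ c) :
    ∃ i a, a ≠ q i ∧ (S.filter (fun x => x i = a)).Nonempty ∧
      ((S.filter (fun x => x i = a)).card : ℝ) ≤ t := by
  by_contra! hcon
  have hn : (0:ℝ) < S.card := by exact_mod_cast hS.card_pos
  have hbig : t < S.card := by
    obtain ⟨x, hx⟩ := hS
    have : ∃ i, x i ≠ q i := by
      by_contra! h
      exact hq ((funext h : x = q) ▸ hx)
    obtain ⟨i, hi⟩ := this
    refine (hcon i (x i) hi ⟨x, by simp [hx]⟩).trans_le ?_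
    exact_mod_cast Finset.card_filter_le _ _
  have hcoord : ∀ i, ((S.image (fun x => x i)).card : ℝ) < 2 * S.card / t := by
    intro i
    set I := (S.image (fun x => x i)).erase (q i) with hI
    have h1 : (S.image (fun x => x i)).card ≤ I.card + 1 := by
      have := Finset.pred_card_le_card_erase (s := S.image (fun x => x i)) (a := q i)
      rw [← hI] at this
      omega
    have h2 : (I.card : ℝ) * t ≤ S.card := by
      have h3 : ∑ a ∈ I, (S.filter (fun x => x i = a)).card ≤ S.card := by
        have h4 : (S.filter (fun x => x i ∈ I)).card = ∑ a ∈ I, ((S.filter (fun x => x i ∈ I)).filter (fun x => x i = a)).card :=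
          Finset.card_eq_sum_card_fiberwise (fun x hx => (Finset.mem_filter.1 hx).2)
        have h5 : ∑ a ∈ I, ((S.filter (fun x => x i ∈ I)).filter (fun x => x i = a)).card = ∑ a ∈ I, (S.filter (fun x => x i = a)).card := by
          apply Finset.sum_congr rfl
          intro a ha
          congr 1
          ext x
          simp only [Finset.mem_filter]
          constructor
          · rintro ⟨⟨h, _⟩, h'⟩; exact ⟨h, h'⟩
          · rintro ⟨h, h'⟩; exact ⟨⟨h, h' ▸ ha⟩, h'⟩
        rw [← h5, ← h4]
        exact Finset.card_filter_le _ _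
      calc (I.card : ℝ) * t = ∑ a ∈ I, t := by simp
        _ ≤ ∑ a ∈ I, ((S.filter (fun x => x i = a)).card : ℝ) := by
          apply Finset.sum_le_sum
          intro a ha
          obtain ⟨h, h'⟩ := Finset.mem_erase.1 ha
          obtain ⟨x, hx, hxa⟩ := Finset.mem_image.1 h'
          exact (hcon i a h ⟨x, by simp [hx, hxa]⟩).le
        _ ≤ S.card := by exact_mod_cast h3
    rw [lt_div_iff₀ ht]
    have h1' : ((S.image (fun x => x i)).card : ℝ) ≤ I.card + 1 := by exact_mod_cast h1
    nlinarith
  have hsub : S ⊆ Fintype.piFinset (fun i => S.image (fun x => x i)) := by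
    intro x hx
    rw [Fintype.mem_piFinset]
    intro i
    exact Finset.mem_image_of_mem _ hx
  have h1 := Finset.card_le_card hsub
  rw [Fintype.card_piFinset] at h1
  have h2 : (S.card : ℝ) ≤ ∏ i : Fin c, ((S.image (fun x => x i)).card : ℝ) := by exact_mod_cast h1
  have h3 : ∏ i : Fin c, ((S.image (fun x => x i)).card : ℝ) < ∏ i : Fin c, (2 * S.card / t) := by
    have : Nonempty (Fin c) := ⟨⟨0, by omega⟩⟩
    apply Finset.prod_lt_prod_of_nonempty
    · intro i _
      have := (hS.image (fun x => x i)).card_pos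
      exact_mod_cast this
    · intro i _; exact hcoord i
    · exact Finset.univ_nonempty
  simp only [Finset.prod_const, Finset.card_univ, Fintype.card_fin] at h3
  have h4 := h2.trans_lt h3
  rw [div_pow, lt_div_iff₀ (by positivity), mul_pow] at h4
  have h5 : (S.card : ℝ) ^ c = S.card * (S.card : ℝ) ^ (c-1) := by
    rw [← pow_succ']; congr 1; omega
  rw [h5] at h4
  nlinarith

theorem mgf_pt (d : ℕ) (hd : 0 < d) (x : ℕ) (hx : x ≤ d) (lam : ℝ) :
    Real.exp (lam * x) ≤ 1 + (Real.exp (lam * d) - 1) / d * x := by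
  have hd' : (0:ℝ) < d := by exact_mod_cast hd
  have hx' : (x:ℝ) ≤ d := by exact_mod_cast hx
  have h := convexOn_exp.2 (Set.mem_univ (0:ℝ)) (Set.mem_univ (lam * d))
    (show (0:ℝ) ≤ 1 - (x:ℝ)/(d:ℝ) by rw [sub_nonneg, div_le_one hd']; exact hx')
    (show (0:ℝ) ≤ (x:ℝ)/(d:ℝ) by positivity) (by ring)
  simp only [smul_eq_mul, mul_zero, zero_add, Real.exp_zero, mul_one] at h
  have e1 : (x:ℝ)/d * (lam * d) = lam * x := by field_simp
  rw [e1] at h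
  refine h.trans (le_of_eq ?_)
  ring

theorem main_ind [Fintype A] [Fintype V] (hc : 1 ≤ c) (q : Fin c → A) (F : V → V) (n : ℕ)
    (t : ℝ) (ht : 0 < t) (htn : (2:ℝ) ^ c * (n : ℝ) ^ (c-1) ≤ t ^ c) (k : ℕ) (hk : 0 < k) :
    ∀ (s : ℕ) (S : Finset (Fin c → A)), S.card = s → q ∉ S → s ≤ n →
    ∃ Bad : (Fin c → A → V) → Prop,
      (∀ i a, a ≠ q i → (∀ x ∈ S, x i ≠ a) → ∀ T v, Bad (T + eSh i a v) ↔ Bad T) ∧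
      (∑ T, (if Bad T then (1:ℝ) else 0) ≤
        s * (Fintype.card (Fin c → A → V) * (Fintype.card V * (t / Fintype.card V) ^ (k+1)))) ∧
      ∀ lam : ℝ, ∑ T, (if Bad T then 0 else
          Real.exp (lam * (S.filter (fun x => gH T x = F (gH T q))).card)) ≤
        Fintype.card (Fin c → A → V) *
          Real.exp ((Real.exp (lam * (k ^ c : ℕ)) - 1) / (k ^ c : ℕ) * (s / Fintype.card V)) := by
  intro s
  have hV : (0:ℝ) < Fintype.card V := by exact_mod_cast Fintype.card_pos
  induction s using Nat.strong_induction_on with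
  | _ s ih =>
  intro S hs hq hsn
  rcases S.eq_empty_or_nonempty with rfl | hne
  · refine ⟨fun _ => False, by simp, ?_, ?_⟩
    · simp at hs; simp [← hs]
    · intro lam
      simp at hs; simp [← hs]
  have htS : (2:ℝ) ^ c * (S.card : ℝ) ^ (c-1) ≤ t ^ c := by
    refine le_trans ?_ htn
    have : (S.card : ℝ) ≤ n := by rw [hs]; exact_mod_cast hsn
    gcongr
  obtain ⟨i, a, haq, hGne, hGt⟩ := exists_group hc S q hq hne t ht htS
  set G := S.filter (fun x => x i = a) with hG
  set S' := S.filter (fun x => ¬ x i = a) with hS'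
  have hcard : G.card + S'.card = s := by
    rw [← hs]; exact Finset.card_filter_add_card_filter_not _
  have hGpos := hGne.card_pos
  obtain ⟨B, hB1, hB2, hB3⟩ := ih S'.card (by omega) S' rfl
    (fun h => hq (Finset.mem_filter.1 h).1) (by omega)
  have hE : (0:ℝ) ≤ Fintype.card (Fin c → A → V) * (Fintype.card V * (t / Fintype.card V) ^ (k+1)) := by positivity
  have hGS : ∀ x ∈ G, x ∈ S ∧ x i = a := fun x hx => Finset.mem_filter.1 hx
  have hSS : ∀ x ∈ S', x ∈ S ∧ x i ≠ a := fun x hx => Finset.mem_filter.1 hx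
  let GB : (Fin c → A → V) → Prop := fun T => ∃ v, k ^ c < (G.filter (fun x => gH T x = v)).card
  obtain ⟨BS, hBS⟩ : ∃ BS : (Fin c → A → V) → Prop, ∀ T, BS T ↔ (B T ∨ GB T) := ⟨_, fun T => Iff.rfl⟩
  refine ⟨BS, ?_, ?_, ?_⟩
  · intro j y hy hyS T v
    rw [hBS, hBS]
    refine or_congr (hB1 j y hy (fun x hx => hyS x (hSS x hx).1) T v) ?_
    have : ∀ w, G.filter (fun x => gH (T + eSh j y v) x = w) = G.filter (fun x => gH T x = w) := by
      intro w
      apply Finset.filter_congr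
      intro x hx
      rw [gH_shift, if_neg (hyS x (hGS x hx).1), add_zero]
    simp only [GB, this]
  · calc ∑ T, (if BS T then (1:ℝ) else 0)
        ≤ ∑ T, ((if B T then (1:ℝ) else 0) + (if GB T then (1:ℝ) else 0)) := by
          apply Finset.sum_le_sum
          intro T _
          have := hBS T
          by_cases h1 : B T <;> by_cases h2 : GB T <;> simp [h1, h2, this]
      _ ≤ S'.card * (Fintype.card (Fin c → A → V) * (Fintype.card V * (t / Fintype.card V) ^ (k+1)))
          + 1 * (Fintype.card (Fin c → A → V) * (Fintype.card V * (t / Fintype.card V) ^ (k+1))) := by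
          rw [Finset.sum_add_distrib]
          refine add_le_add hB2 ?_
          rw [one_mul]
          refine (bad_bound G k).trans ?_
          gcongr
      _ ≤ s * (Fintype.card (Fin c → A → V) * (Fintype.card V * (t / Fintype.card V) ^ (k+1))) := by
          rw [← add_mul]
          apply mul_le_mul_of_nonneg_right _ hE
          have : S'.card + 1 ≤ s := by omega
          exact_mod_cast this
  · intro lam
    set kap := (Real.exp (lam * (k ^ c : ℕ)) - 1) / (k ^ c : ℕ) with hkap
    have hd : 0 < k ^ c := by positivity
    let W : (Fin c → A → V) → ℝ := fun T => if BS T then 0 else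
      Real.exp (lam * (S'.filter (fun x => gH T x = F (gH T q))).card)
    have hW0 : ∀ T, 0 ≤ W T := by intro T; simp only [W]; split_ifs <;> positivity
    have hqs : ∀ (T : Fin c → A → V) v, gH (T + eSh i a v) q = gH T q := by
      intro T v; rw [gH_shift, if_neg (Ne.symm haq), add_zero]
    have hWinv : ∀ T v, W (T + eSh i a v) = W T := by
      intro T v
      have e1 : B (T + eSh i a v) ↔ B T := hB1 i a haq (fun x hx => (hSS x hx).2) T v
      have e2 : GB (T + eSh i a v) ↔ GB T := by
        have : ∀ w, G.filter (fun x => gH (T + eSh i a v) x = w) = G.filter (fun x => gH T x = w - v) := by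
          intro w
          apply Finset.filter_congr
          intro x hx
          rw [gH_shift, if_pos (hGS x hx).2, eq_sub_iff_add_eq]
        simp only [GB, this]
        constructor
        · rintro ⟨w, hw⟩; exact ⟨_, hw⟩
        · rintro ⟨w, hw⟩; exact ⟨w + v, by simpa using hw⟩
      have e3 : S'.filter (fun x => gH (T + eSh i a v) x = F (gH (T + eSh i a v) q)) =
          S'.filter (fun x => gH T x = F (gH T q)) := by
        apply Finset.filter_congr
        intro x hx
        rw [hqs, gH_shift, if_neg (hSS x hx).2, add_zero]
      have e4 : BS (T + eSh i a v) ↔ BS T := by rw [hBS, hBS, e1, e2]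
      simp only [W, e4, e3]
    have hsplit : ∀ T, (if BS T then 0 else
        Real.exp (lam * (S.filter (fun x => gH T x = F (gH T q))).card)) =
        W T * Real.exp (lam * (G.filter (fun x => gH T x = F (gH T q))).card) := by
      intro T
      simp only [W]
      split_ifs with h
      · simp
      · rw [← Real.exp_add, ← mul_add]
        congr 2
        have : (S.filter (fun x => gH T x = F (gH T q))).card =
          (S'.filter (fun x => gH T x = F (gH T q))).card + (G.filter (fun x => gH T x = F (gH T q))).card := by
          rw [hG, hS', Finset.filter_comm, Finset.filter_comm (s := S) (p := fun x : Fin c → A => x i = a), add_comm]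
          exact (Finset.card_filter_add_card_filter_not _).symm
        rw [this]; push_cast; rfl
    have hinner : ∀ T, ∑ v : V, W (T + eSh i a v) *
        Real.exp (lam * (G.filter (fun x => gH (T + eSh i a v) x = F (gH (T + eSh i a v) q))).card)
        ≤ W T * (Fintype.card V * Real.exp (kap * (G.card / Fintype.card V))) := by
      intro T
      simp only [hWinv]
      rw [← Finset.mul_sum]
      by_cases hbad : BS T
      · have : W T = 0 := by simp only [W]; rw [if_pos hbad]
        simp [this]
      apply mul_le_mul_of_nonneg_left _ (hW0 T)
      have hgood : ∀ v, (G.filter (fun x => gH T x = v)).card ≤ k ^ c := by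
        intro v
        by_contra! h
        exact hbad ((hBS T).2 <| Or.inr ⟨v, h⟩)
      have e1 : ∀ v, G.filter (fun x => gH (T + eSh i a v) x = F (gH (T + eSh i a v) q)) =
          G.filter (fun x => gH T x = F (gH T q) - v) := by
        intro v
        apply Finset.filter_congr
        intro x hx
        rw [hqs, gH_shift, if_pos (hGS x hx).2, eq_sub_iff_add_eq]
      simp only [e1]
      have e2 : ∑ v : V, Real.exp (lam * (G.filter (fun x => gH T x = F (gH T q) - v)).card) =
          ∑ v : V, Real.exp (lam * (G.filter (fun x => gH T x = v)).card) :=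
        Fintype.sum_equiv (Equiv.subLeft (F (gH T q))) _ _ (fun v => rfl)
      rw [e2]
      calc ∑ v : V, Real.exp (lam * (G.filter (fun x => gH T x = v)).card)
          ≤ ∑ v : V, (1 + kap * (G.filter (fun x => gH T x = v)).card) :=
            Finset.sum_le_sum (fun v _ => mgf_pt (k ^ c) hd _ (hgood v) lam)
        _ = Fintype.card V + kap * G.card := by
            rw [Finset.sum_add_distrib, ← Finset.mul_sum]
            congr 1
            · simp
            · congr 1
              have := Finset.card_eq_sum_card_fiberwise (s := G) (t := Finset.univ) (f := fun x => gH T x) (by intro x _; simp)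
              rw [this]; push_cast; rfl
        _ = Fintype.card V * (kap * (G.card / Fintype.card V) + 1) := by field_simp; ring
        _ ≤ _ := by
            gcongr
            exact Real.add_one_le_exp _
    have hfin : (Fintype.card V : ℝ) * ∑ T, W T * Real.exp (lam * (G.filter (fun x => gH T x = F (gH T q))).card)
        ≤ Fintype.card V * (Real.exp (kap * (G.card / Fintype.card V)) * ∑ T, W T) := by
      rw [sum_avg _ i a]
      refine (Finset.sum_le_sum (fun T _ => hinner T)).trans (le_of_eq ?_)
      rw [← Finset.sum_mul]; ring
    have hfin' := le_of_mul_le_mul_left hfin hV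
    simp only [hsplit]
    refine hfin'.trans ?_
    have hWB : ∑ T, W T ≤ Fintype.card (Fin c → A → V) * Real.exp (kap * (S'.card / Fintype.card V)) := by
      refine le_trans (Finset.sum_le_sum ?_) (hB3 lam)
      intro T _
      simp only [W]
      have := hBS T
      by_cases h1 : B T <;> by_cases h2 : GB T <;> simp [h1, h2, this] <;> positivity
    calc Real.exp (kap * (G.card / Fintype.card V)) * ∑ T, W T 
        ≤ Real.exp (kap * (G.card / Fintype.card V)) * (Fintype.card (Fin c → A → V) * Real.exp (kap * (S'.card / Fintype.card V))) := by gcongr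
      _ = Fintype.card (Fin c → A → V) * (Real.exp (kap * (G.card / Fintype.card V)) * Real.exp (kap * (S'.card / Fintype.card V))) := by ring
      _ = _ := by
        rw [← Real.exp_add]
        congr 2
        rw [← hcard]; push_cast; ring

end helpers

theorem cher_aux (s y : ℝ) (hs : |s| ≤ 1) : Real.exp s - 1 - s * y ≤ s ^ 2 + s - s * y := by
  have := (abs_le.1 (Real.abs_exp_sub_one_sub_id_le hs)).2
  linarith

theorem bad_num (c : ℕ) (hc : 1 ≤ c) (γ : ℝ) (k : ℕ) (hk : 2 * (c:ℝ) * (γ + 3) ≤ (k:ℝ) + 1)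
    (n : ℕ) (m : ℝ) (hm : 1 ≤ m) (hmn : m ≤ n) (h : (n:ℝ) ^ ((1 : ℝ) - 1 / (2 * (c : ℝ))) ≤ m) :
    (n:ℝ) * (m * (2 * (n:ℝ) ^ ((1:ℝ) - 1 / c) / m) ^ (k+1)) ≤ 2 ^ (k+1) * m ^ (-γ) := by
  have hc' : (1:ℝ) ≤ c := by exact_mod_cast hc
  have hm0 : 0 < m := by linarith
  have hn1 : (1:ℝ) ≤ n := hm.trans hmn
  have hn0 : (0:ℝ) < n := by linarith
  have hn2 : (n:ℝ) ≤ m ^ (2:ℝ) := by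
    have h1 : (n:ℝ) ^ ((1:ℝ)/2) ≤ m := by
      refine le_trans (Real.rpow_le_rpow_of_exponent_le hn1 ?_) h
      have : 1 / (2 * (c:ℝ)) ≤ 1 / 2 := by
        apply one_div_le_one_div_of_le <;> linarith
      linarith
    calc (n:ℝ) = ((n:ℝ) ^ ((1:ℝ)/2)) ^ (2:ℝ) := by
          rw [← Real.rpow_mul hn0.le]; norm_num
      _ ≤ m ^ (2:ℝ) := Real.rpow_le_rpow (by positivity) h1 (by norm_num)
  have h3 : 2 * (n:ℝ) ^ ((1:ℝ) - 1 / c) / m ≤ 2 * m ^ (-(1 / (2 * (c:ℝ)))) := by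
    rw [div_le_iff₀ hm0]
    have e : (n:ℝ) ^ ((1:ℝ) - 1 / c) = (n:ℝ) ^ (-(1 / (2 * (c:ℝ)))) * (n:ℝ) ^ ((1 : ℝ) - 1 / (2 * (c : ℝ))) := by
      rw [← Real.rpow_add hn0]; congr 1; field_simp; ring
    have e2 : (n:ℝ) ^ (-(1 / (2 * (c:ℝ)))) ≤ m ^ (-(1 / (2 * (c:ℝ)))) := by
      apply Real.rpow_le_rpow_of_nonpos hm0 hmn
      have : 0 ≤ 1 / (2 * (c:ℝ)) := by positivity
      linarith
    rw [e, mul_assoc]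
    gcongr
  have h4 : (2 * m ^ (-(1 / (2 * (c:ℝ))))) ^ (k+1) ≤ 2 ^ (k+1) * m ^ (-(γ+3)) := by
    rw [mul_pow]
    gcongr
    rw [← Real.rpow_natCast, ← Real.rpow_mul hm0.le]
    apply Real.rpow_le_rpow_of_exponent_le hm
    push_cast
    rw [neg_mul, neg_le_neg_iff, one_div, inv_mul_eq_div, le_div_iff₀ (by positivity)]
    linarith
  calc (n:ℝ) * (m * (2 * (n:ℝ) ^ ((1:ℝ) - 1 / c) / m) ^ (k+1))
      ≤ m ^ (2:ℝ) * (m ^ (1:ℝ) * (2 ^ (k+1) * m ^ (-(γ+3)))) := by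
        rw [Real.rpow_one]
        gcongr
        exact le_trans (by gcongr) h4
    _ = 2 ^ (k+1) * (m ^ (2:ℝ) * m ^ (1:ℝ) * m ^ (-(γ+3))) := by ring
    _ = 2 ^ (k+1) * m ^ (-γ) := by
        rw [← Real.rpow_add hm0, ← Real.rpow_add hm0]; congr 2; ring

/-- Chernoff-type concentration for simple tabulation, query-dependent bin,
relative deviation `δ ≤ 1`. -/
theorem simple_tabulation_chernoff_small_delta :
    ∀ c : ℕ, 1 ≤ c → ∀ γ : ℝ, 0 < γ →
    ∃ a C : ℝ, 0 < a ∧ 0 < C ∧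
      ∀ (A : Type) [Fintype A] (b : ℕ) (S : Finset (Fin c → A)) (q : Fin c → A)
        (F : (Fin b → ZMod 2) → (Fin b → ZMod 2)),
        q ∉ S →
        ((2 : ℝ) ^ b) ≥ (S.card : ℝ) ^ ((1 : ℝ) - 1 / (2 * (c : ℝ))) →
        ∀ δ : ℝ, 0 < δ → δ ≤ 1 →
          tabPr c b A (fun T =>
              |((S.filter (fun x => tabHash T x = F (tabHash T q))).card : ℝ) -
                  (S.card : ℝ) / 2 ^ b| > δ * ((S.card : ℝ) / 2 ^ b)) ≤
            2 * Real.exp (-(a * δ ^ 2 * ((S.card : ℝ) / 2 ^ b))) +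
              C * ((2 : ℝ) ^ b) ^ (-γ) := by
  intro c hc γ hγ
  obtain ⟨k, hk⟩ := exists_nat_ge (2 * (c:ℝ) * (γ + 3))
  have hc' : (1:ℝ) ≤ c := by exact_mod_cast hc
  have hk0 : 0 < k := by
    have : (0:ℝ) < k := lt_of_lt_of_le (by positivity) hk
    exact_mod_cast this
  have hd : (1:ℝ) ≤ (k ^ c : ℕ) := by exact_mod_cast Nat.one_le_iff_ne_zero.2 (pow_pos hk0 c).ne'
  set d : ℝ := ((k ^ c : ℕ) : ℝ) with hdd
  have hd0 : 0 < d := by linarith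
  refine ⟨1 / (4 * d), 2 ^ (k+1), by positivity, by positivity, ?_⟩
  intro A _ b S q F hq hS δ hδ hδ1
  classical
  have hm : (1:ℝ) ≤ 2 ^ b := one_le_pow₀ (by norm_num)
  set m : ℝ := 2 ^ b with hmm
  have hm0 : 0 < m := by linarith
  have hcV : (Fintype.card (Fin b → ZMod 2) : ℝ) = m := by simp [ZMod.card, hmm]
  set n : ℕ := S.card with hn
  set μ : ℝ := (n:ℝ) / m with hμ
  have hμ0 : 0 ≤ μ := by positivity
  set N : ℝ := (Fintype.card (Fin c → A → (Fin b → ZMod 2)) : ℝ) with hN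
  have hN0 : 0 < N := by rw [hN]; exact_mod_cast Fintype.card_pos
  set P : (Fin c → A → (Fin b → ZMod 2)) → Prop := fun T =>
              |((S.filter (fun x => tabHash T x = F (tabHash T q))).card : ℝ) - μ| > δ * μ with hP
  have hpr : tabPr c b A P = (∑ T, if P T then (1:ℝ) else 0) / N := by
    unfold tabPr
    rw [Nat.card_eq_fintype_card, Nat.card_eq_fintype_card, Fintype.card_subtype]
    simp [hN]
  change tabPr c b A P ≤ _
  rw [hpr, div_le_iff₀ hN0]
  have hlast : 0 ≤ (2:ℝ) ^ (k+1) * m ^ (-γ) := by positivity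
  rcases lt_or_ge (n:ℝ) m with hnm | hnm
  · have h1 : ∑ T, (if P T then (1:ℝ) else 0) ≤ 1 * N := by
      refine (Finset.sum_le_sum (g := fun _ => (1:ℝ)) ?_).trans ?_
      · intro T _; split_ifs <;> norm_num
      · simp [hN]
    refine h1.trans ?_
    apply mul_le_mul_of_nonneg_right _ hN0.le
    have hμ1 : μ ≤ 1 := by rw [hμ, div_le_one hm0]; exact hnm.le
    have h2 : 1 / (4 * d) * δ ^ 2 * μ ≤ 1 / 4 := by
      have : 1 / (4 * d) ≤ 1 / 4 := by apply one_div_le_one_div_of_le <;> linarith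
      calc 1 / (4 * d) * δ ^ 2 * μ ≤ 1 / 4 * 1 ^ 2 * 1 := by gcongr
        _ = 1/4 := by norm_num
    have h3 := Real.add_one_le_exp (-(1 / (4 * d) * δ ^ 2 * μ))
    linarith
  have hn0 : (0:ℝ) < n := by linarith
  set t : ℝ := 2 * (n:ℝ) ^ ((1:ℝ) - 1 / c) with ht
  have ht0 : 0 < t := by positivity
  have htn : (2:ℝ) ^ c * (n : ℝ) ^ (c-1) ≤ t ^ c := by
    rw [ht, mul_pow]
    apply le_of_eq
    congr 1
    rw [← Real.rpow_natCast, ← Real.rpow_natCast, ← Real.rpow_mul hn0.le]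
    congr 1
    rw [Nat.cast_sub hc]
    field_simp
    simp
  obtain ⟨B, -, hB2, hB3⟩ := main_ind hc q F n t ht0 htn k hk0 n S rfl hq le_rfl
  rw [hcV, ← hN] at hB2
  rw [hcV, ← hN] at hB3
  have hbn := bad_num c hc γ k (by linarith) n m hm hnm hS
  set X : (Fin c → A → (Fin b → ZMod 2)) → ℝ := fun T =>
    ((S.filter (fun x => tabHash T x = F (tabHash T q))).card : ℝ) with hX
  have hB3' : ∀ lam : ℝ, ∑ T, (if B T then 0 else Real.exp (lam * X T)) ≤
      N * Real.exp ((Real.exp (lam * d) - 1) / d * μ) := by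
    intro lam
    refine le_trans (le_of_eq ?_) (hB3 lam)
    apply Finset.sum_congr rfl
    intro T _
    by_cases hb : B T
    · simp [hb]
    · simp only [hb, if_false, hX]
      congr
  have hdev : ∀ lam y : ℝ, |lam * d| ≤ 1 →
      ∑ T, (if B T then 0 else Real.exp (lam * X T)) * Real.exp (-(lam * (y * μ))) ≤
      N * Real.exp (μ / d * ((lam*d)^2 + lam * d - lam * d * y)) := by
    intro lam y hl
    rw [← Finset.sum_mul]
    refine (mul_le_mul_of_nonneg_right (hB3' lam) (Real.exp_pos _).le).trans ?_
    rw [mul_assoc, ← Real.exp_add]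
    apply mul_le_mul_of_nonneg_left _ hN0.le
    apply Real.exp_le_exp.2
    have := mul_le_mul_of_nonneg_left (cher_aux (lam*d) y hl) (show 0 ≤ μ / d by positivity)
    refine le_trans (le_of_eq ?_) this
    field_simp
    ring
  have hup := hdev (δ / 2 / d) (1 + δ) (by
    rw [div_mul_cancel₀ _ hd0.ne', abs_of_pos (by positivity)]; linarith)
  have hlo := hdev (-(δ / 2 / d)) (1 - δ) (by
    rw [neg_mul, abs_neg, div_mul_cancel₀ _ hd0.ne', abs_of_pos (by positivity)]; linarith)
  have e1 : μ / d * ((δ / 2 / d * d)^2 + δ / 2 / d * d - δ / 2 / d * d * (1 + δ)) = -(1 / (4 * d) * δ ^ 2 * μ) := by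
    field_simp; ring
  have e2 : μ / d * ((-(δ / 2 / d) * d)^2 + -(δ / 2 / d) * d - -(δ / 2 / d) * d * (1 - δ)) = -(1 / (4 * d) * δ ^ 2 * μ) := by
    field_simp; ring
  rw [e1] at hup
  rw [e2] at hlo
  set lam := δ / 2 / d with hlam
  have hlam0 : 0 < lam := by positivity
  have hpt : ∀ T, (if P T then (1:ℝ) else 0) ≤ (if B T then (1:ℝ) else 0) +
      ((if B T then 0 else Real.exp (lam * X T)) * Real.exp (-(lam * ((1+δ) * μ))) +
       (if B T then 0 else Real.exp (-lam * X T)) * Real.exp (-(-lam * ((1-δ) * μ)))) := by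
    intro T
    by_cases hb : B T
    · simp only [hb, if_true, zero_mul, add_zero]
      split_ifs <;> norm_num
    simp only [hb, if_false, zero_add]
    rw [← Real.exp_add, ← Real.exp_add]
    split_ifs with hp
    · have hp' : δ * μ < |X T - μ| := hp
      rcases lt_abs.1 hp' with h | h
      · have : 1 ≤ Real.exp (lam * X T + -(lam * ((1+δ) * μ))) := by
          apply Real.one_le_exp
          have := mul_nonneg hlam0.le (show 0 ≤ X T - (1+δ)*μ by linarith)
          linarith
        have := Real.exp_pos (-lam * X T + -(-lam * ((1-δ) * μ)))
        linarith
      · have : 1 ≤ Real.exp (-lam * X T + -(-lam * ((1-δ) * μ))) := by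
          apply Real.one_le_exp
          have := mul_nonneg hlam0.le (show 0 ≤ (1-δ)*μ - X T by linarith)
          linarith
        have := Real.exp_pos (lam * X T + -(lam * ((1+δ) * μ)))
        linarith
    · positivity
  have hB2' : ∑ T, (if B T then (1:ℝ) else 0) ≤ n * (N * (m * (t / m) ^ (k + 1))) := by
    refine le_trans (le_of_eq ?_) hB2
    apply Finset.sum_congr rfl
    intro T _
    congr
  refine (Finset.sum_le_sum (fun T _ => hpt T)).trans ?_
  rw [Finset.sum_add_distrib, Finset.sum_add_distrib]
  have h5 := mul_le_mul_of_nonneg_left hbn hN0.le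
  linarith
end

section
/- For every number of characters c ≥ 1, every constant γ > 0, and every δ₀ > 0 there exist constants a > 0 and C > 0 (depending only on c, γ, δ₀) such that the following holds. Let Σ be a finite alphabet, let m = 2^b, let S ⊆ Σ^c be a set of n keys with m ≥ n^{1−1/(2c)}, let q ∈ Σ^c \ S be a query key, and let F : (ZMod 2)^b → (ZMod 2)^b be an arbitrary function. Hash by a random simple tabulation hash function h into m bins, let X_q = |{x ∈ S : h(x) = F(h(q))}|, and let μ = n/m. Then for every real δ ≥ δ₀, Pr[X_q > (1+δ)·μ] ≤ (1+δ)^{−a·(1+δ)·μ} + C·m^{−γ}. -/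
open Finset

section aux

lemma tabHash_add {c b : ℕ} {A : Type} (T D : Fin c → A → (Fin b → ZMod 2)) (x : Fin c → A) :
    tabHash (T + D) x = tabHash T x + tabHash D x := by
  simp [tabHash, Finset.sum_add_distrib]

lemma tabHash_sum {c b : ℕ} {A : Type} {ι : Type} (s : Finset ι)
    (D : ι → Fin c → A → (Fin b → ZMod 2)) (x : Fin c → A) :
    tabHash (∑ k ∈ s, D k) x = ∑ k ∈ s, tabHash (D k) x := by
  simp only [tabHash, Finset.sum_apply]
  rw [Finset.sum_comm]

open Classical in
/-- Elementary table. -/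
noncomputable def eTab {c b : ℕ} {A : Type} (i : Fin c) (a : A) (v : Fin b → ZMod 2) :
    Fin c → A → (Fin b → ZMod 2) :=
  fun j a' => if j = i ∧ a' = a then v else 0

open Classical in
lemma tabHash_eTab {c b : ℕ} {A : Type} (i : Fin c) (a : A) (v : Fin b → ZMod 2)
    (x : Fin c → A) : tabHash (eTab i a v) x = if x i = a then v else 0 := by
  unfold tabHash eTab
  rw [Finset.sum_eq_single i]
  · simp
  · intro j _ hj; simp [hj]
  · simp

lemma card_V (b : ℕ) : Fintype.card (Fin b → ZMod 2) = 2 ^ b := by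
  simp [ZMod.card]

open Classical in
lemma tuple_bound {c b : ℕ} {A : Type} [Fintype A] (t : ℕ) (x : Fin (t + 1) → Fin c → A)
    (i : Fin c) (hinj : Function.Injective (fun j => x j i)) :
    (2 ^ b) ^ t * #{T : Fin c → A → (Fin b → ZMod 2) | ∀ j, tabHash T (x j) = tabHash T (x 0)}
      ≤ Fintype.card (Fin c → A → (Fin b → ZMod 2)) := by
  let D : (Fin t → (Fin b → ZMod 2)) → (Fin c → A → (Fin b → ZMod 2)) :=
    fun v => ∑ k, eTab i (x k.succ i) (v k)
  have hD0 : ∀ v, tabHash (D v) (x 0) = 0 := by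
    intro v
    simp only [D, tabHash_sum, tabHash_eTab]
    apply Finset.sum_eq_zero
    intro k _
    rw [if_neg]
    intro h
    exact (Fin.succ_ne_zero k) (hinj h).symm
  have hDs : ∀ v k, tabHash (D v) (x (Fin.succ k)) = v k := by
    intro v k
    simp only [D, tabHash_sum, tabHash_eTab]
    rw [Finset.sum_eq_single k]
    · simp
    · intro j _ hj
      rw [if_neg]
      intro h
      exact hj (Fin.succ_injective _ (hinj h)).symm
    · simp
  have := Finset.card_le_card_of_injOn
    (s := (univ : Finset (Fin t → (Fin b → ZMod 2))) ×ˢ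
      ({T : Fin c → A → (Fin b → ZMod 2) | ∀ j, tabHash T (x j) = tabHash T (x 0)} : Finset _))
    (t := (univ : Finset (Fin c → A → (Fin b → ZMod 2))))
    (fun p => p.2 + D p.1) (by simp) (by
      rintro ⟨v, T⟩ h ⟨v', T'⟩ h' heq
      simp only [coe_product, Set.mem_prod, mem_coe, mem_filter, mem_univ, true_and] at h h' heq
      have hv : v = v' := by
        funext k
        have e1 := congrArg (fun U => tabHash U (x k.succ)) heq
        have e0 := congrArg (fun U => tabHash U (x 0)) heq
        simp only [tabHash_add, hD0, hDs, h k.succ, h' k.succ, add_zero] at e1 e0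
        rw [e0] at e1
        exact add_left_cancel e1
      subst hv
      simpa using heq)
  rw [Finset.card_product, Finset.card_univ, Finset.card_univ, Fintype.card_fun, card_V,
    Fintype.card_fin] at this
  exact this

open Classical in
lemma pigeon {c : ℕ} {A : Type} (t : ℕ) (K : Finset (Fin c → A)) (h : t ^ c < #K) :
    ∃ i, ∃ x : Fin (t + 1) → Fin c → A, (∀ j, x j ∈ K) ∧
      Function.Injective (fun j => x j i) := by
  obtain ⟨i, hi⟩ : ∃ i, t < #(K.image (fun x => x i)) := by
    by_contra! hcon
    have h1 : K ⊆ Fintype.piFinset (fun i => K.image (fun x => x i)) := by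
      intro x hx
      rw [Fintype.mem_piFinset]
      intro i
      exact mem_image_of_mem (fun x : Fin c → A => x i) hx
    have h2 := card_le_card h1
    rw [Fintype.card_piFinset] at h2
    have h3 : ∏ i : Fin c, #(K.image (fun x => x i)) ≤ ∏ i : Fin c, t :=
      Finset.prod_le_prod' (fun i _ => hcon i)
    simp at h3
    omega
  obtain ⟨f⟩ : Nonempty (Fin (t + 1) ↪ (K.image (fun x => x i))) :=
    Function.Embedding.nonempty_of_card_le (by simpa using hi)
  have hf : ∀ j, ∃ x ∈ K, x i = (f j : A) := fun j => by
    exact mem_image.1 (f j).2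
  choose x hx hxi using hf
  refine ⟨i, x, hx, ?_⟩
  intro j k hjk
  simp only [hxi] at hjk
  exact f.injective (Subtype.ext hjk)

open Classical in
lemma bounded_lemma {c b : ℕ} {A : Type} [Fintype A] (t : ℕ) (G : Finset (Fin c → A)) :
    (2 ^ b) ^ t * #{T : Fin c → A → (Fin b → ZMod 2) |
        ∃ y, t ^ c < #{x ∈ G | tabHash T x = y}}
      ≤ c * #G ^ (t + 1) * Fintype.card (Fin c → A → (Fin b → ZMod 2)) := by
  let I : Finset (Fin c × (Fin (t + 1) → Fin c → A)) :=
    ((univ : Finset (Fin c)) ×ˢ Fintype.piFinset (fun _ : Fin (t + 1) => G)).filter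
      (fun p => Function.Injective (fun j => p.2 j p.1))
  have hI : #I ≤ c * #G ^ (t + 1) := by
    refine (card_filter_le _ _).trans ?_
    rw [card_product, Fintype.card_piFinset]
    simp
  have hsub : ({T : Fin c → A → (Fin b → ZMod 2) |
        ∃ y, t ^ c < #{x ∈ G | tabHash T x = y}} : Finset _) ⊆
      I.biUnion (fun p => ({T : Fin c → A → (Fin b → ZMod 2) |
        ∀ j, tabHash T (p.2 j) = tabHash T (p.2 0)} : Finset _)) := by
    intro T hT
    simp only [mem_filter, mem_univ, true_and] at hT
    obtain ⟨y, hy⟩ := hT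
    obtain ⟨i, x, hx, hinj⟩ := pigeon t _ hy
    simp only [mem_filter] at hx
    simp only [mem_biUnion, mem_filter, mem_univ, true_and, I, mem_product, Fintype.mem_piFinset]
    exact ⟨(i, x), ⟨fun j => (hx j).1, hinj⟩, fun j => (hx j).2.trans (hx 0).2.symm⟩
  calc _ ≤ (2 ^ b) ^ t * ∑ p ∈ I, #({T : Fin c → A → (Fin b → ZMod 2) |
        ∀ j, tabHash T (p.2 j) = tabHash T (p.2 0)} : Finset _) := by
        gcongr
        exact (card_le_card hsub).trans card_biUnion_le
    _ ≤ ∑ p ∈ I, Fintype.card (Fin c → A → (Fin b → ZMod 2)) := by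
        rw [mul_sum]
        apply Finset.sum_le_sum
        intro p hp
        exact tuple_bound t p.2 p.1 (mem_filter.1 hp).2
    _ ≤ _ := by
        rw [sum_const, smul_eq_mul]
        gcongr

open Classical in
lemma ordering {c : ℕ} {A : Type} (S : Finset (Fin c → A)) (q : Fin c → A) (hq : q ∉ S)
    (hS : S.Nonempty) : ∃ i a, a ≠ q i ∧ ({x ∈ S | x i = a} : Finset _).Nonempty ∧
      #{x ∈ S | x i = a} ^ c ≤ 2 ^ c * #S ^ (c - 1) := by
  let B : Fin c → Finset A := fun i => (S.image (fun x => x i)).erase (q i)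
  have h1 : insert q S ⊆ Fintype.piFinset (fun i => insert (q i) (B i)) := by
    intro x hx
    rw [Fintype.mem_piFinset]
    intro i
    rcases mem_insert.1 hx with rfl | hx
    · simp
    · by_cases h : x i = q i
      · simp [h]
      · exact mem_insert_of_mem (mem_erase.2 ⟨h, mem_image_of_mem (fun x : Fin c → A => x i) hx⟩)
  have h2 := card_le_card h1
  rw [Fintype.card_piFinset, card_insert_of_notMem hq] at h2
  have hB : ∀ i, #(insert (q i) (B i)) = #(B i) + 1 := fun i =>
    card_insert_of_notMem (by simp [B])
  simp only [hB] at h2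
  have hpos : 0 < #S := hS.card_pos
  have hc : 0 < c := by
    rcases Nat.eq_zero_or_pos c with rfl | h
    · simp at h2; simp [h2] at hS
    · exact h
  obtain ⟨i, hi⟩ : ∃ i, #S + 1 ≤ (#(B i) + 1) ^ c := by
    have : Nonempty (Fin c) := ⟨⟨0, hc⟩⟩
    obtain ⟨i, -, hi⟩ := exists_max_image (univ : Finset (Fin c)) (fun i => #(B i) + 1)
      univ_nonempty
    refine ⟨i, h2.trans ?_⟩
    have h3 : ∏ j : Fin c, (#(B j) + 1) ≤ ∏ j : Fin c, (#(B i) + 1) :=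
      Finset.prod_le_prod' (fun j hj => hi j hj)
    simpa using h3
  have hBpos : 0 < #(B i) := by
    rcases Nat.eq_zero_or_pos (#(B i)) with h | h
    · rw [h, zero_add, one_pow] at hi; omega
    · exact h
  have hsum : ∑ a ∈ B i, #{x ∈ S | x i = a} ≤ #S := by
    rw [← card_biUnion]
    · apply card_le_card
      intro x hx
      simp only [mem_biUnion, mem_filter] at hx
      obtain ⟨_, _, h, _⟩ := hx
      exact h
    · intro a _ a' _ haa
      rw [Function.onFun, disjoint_left]
      intro x hx hx'
      exact haa ((mem_filter.1 hx).2.symm.trans (mem_filter.1 hx').2)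
  obtain ⟨a, ha, hmin⟩ := exists_min_image (B i) (fun a => #{x ∈ S | x i = a})
    (card_pos.1 hBpos)
  have hle : #(B i) * #{x ∈ S | x i = a} ≤ #S := by
    refine le_trans ?_ hsum
    rw [← smul_eq_mul, ← sum_const]
    exact sum_le_sum hmin
  obtain ⟨ha1, ha2⟩ := mem_erase.1 ha
  refine ⟨i, a, ha1, ?_, ?_⟩
  · obtain ⟨x, hx, hxa⟩ := mem_image.1 ha2
    exact ⟨x, mem_filter.2 ⟨hx, hxa⟩⟩
  · have h4 : (#(B i) + 1) * #{x ∈ S | x i = a} ≤ 2 * #S := by nlinarith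
    have h5 := Nat.pow_le_pow_left h4 c
    rw [mul_pow, mul_pow] at h5
    have h6 : #S * #{x ∈ S | x i = a} ^ c ≤ #S * (2 ^ c * #S ^ (c - 1)) := by
      calc _ ≤ (#(B i) + 1) ^ c * #{x ∈ S | x i = a} ^ c := by gcongr; omega
        _ ≤ _ := h5
        _ = _ := by
          obtain ⟨k, rfl⟩ : ∃ k, c = k + 1 := ⟨c - 1, by omega⟩
          simp only [Nat.add_sub_cancel]; ring
    exact Nat.le_of_mul_le_mul_left h6 hpos

lemma bern (w : ℝ) (hw : 1 ≤ w) (d k : ℕ) (hd : 0 < d) (hk : k ≤ d) :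
    w ^ ((k : ℝ) / d) ≤ 1 + (w - 1) / d * k := by
  have hd' : (0 : ℝ) < d := by exact_mod_cast hd
  have h := rpow_one_add_le_one_add_mul_self (s := w - 1) (by linarith)
    (p := (k : ℝ) / d) (by positivity) (by rw [div_le_one hd']; exact_mod_cast hk)
  rw [add_sub_cancel] at h
  refine h.trans (le_of_eq ?_)
  ring

lemma avg {c b : ℕ} {A : Type} [Fintype A] [Fintype (Fin c → A → (Fin b → ZMod 2))]
    (i : Fin c) (a : A)
    (f : (Fin c → A → (Fin b → ZMod 2)) → ℝ) :
    (2 : ℝ) ^ b * ∑ T, f T = ∑ T, ∑ v, f (T + eTab i a v) := by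
  rw [sum_comm]
  have : ∀ v : Fin b → ZMod 2, ∑ T, f (T + eTab i a v) = ∑ T, f T := fun v =>
    Equiv.sum_comp (Equiv.addRight (eTab i a v)) f
  simp only [this, sum_const, Finset.card_univ, card_V, nsmul_eq_mul]
  push_cast
  rfl

lemma sum_shift {c b : ℕ} {A : Type} (G : Finset (Fin c → A)) (g : (Fin c → A) → (Fin b → ZMod 2))
    (y : Fin b → ZMod 2) :
    ∑ v : Fin b → ZMod 2, (#{x ∈ G | g x + v = y} : ℝ) = #G := by
  have : ∑ v : Fin b → ZMod 2, #{x ∈ G | g x + v = y} = #G := by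
    simp only [card_filter]
    rw [sum_comm]
    have : ∀ x ∈ G, ∑ v : Fin b → ZMod 2, (if g x + v = y then 1 else 0) = 1 := by
      intro x _
      rw [Finset.sum_eq_single (y - g x)]
      · simp
      · intro v _ hv
        rw [if_neg]
        rintro rfl
        simp at hv
      · simp
    rw [sum_congr rfl this]
    simp
  exact_mod_cast this

open Classical in
lemma mgf {c b : ℕ} {A : Type} [Fintype A] (q : Fin c → A)
    (F : (Fin b → ZMod 2) → (Fin b → ZMod 2)) (w : ℝ) (hw : 1 ≤ w) (d : ℕ) (hd : 0 < d)
    (p : ℝ) (hp0 : 0 ≤ p) (N : ℕ)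
    (hp : ∀ G : Finset (Fin c → A), #G ^ c ≤ 2 ^ c * N ^ (c - 1) →
      (#{T : Fin c → A → (Fin b → ZMod 2) | ∃ y, d < #{x ∈ G | tabHash T x = y}} : ℝ) ≤
        p * Fintype.card (Fin c → A → (Fin b → ZMod 2))) (S : Finset (Fin c → A)) :
    #S ≤ N → q ∉ S → ∃ Good : Finset (Fin c → A → (Fin b → ZMod 2)),
      (∀ i a v, a ≠ q i → (∀ x ∈ S, x i ≠ a) → ∀ T, T + eTab i a v ∈ Good ↔ T ∈ Good) ∧
      (#Goodᶜ : ℝ) ≤ #S * p * Fintype.card (Fin c → A → (Fin b → ZMod 2)) ∧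
      ∑ T ∈ Good, w ^ ((#{x ∈ S | tabHash T x = F (tabHash T q)} : ℝ) / d) ≤
        Fintype.card (Fin c → A → (Fin b → ZMod 2)) *
          Real.exp ((w - 1) / d * (#S / 2 ^ b)) := by
  induction S using Finset.strongInduction with
  | H S ih =>
  intro hSN hq
  rcases S.eq_empty_or_nonempty with rfl | hS
  · refine ⟨univ, by simp, by simp, by simp⟩
  obtain ⟨i, a, haq, hne, hcard⟩ := ordering S q hq hS
  set G : Finset (Fin c → A) := {x ∈ S | x i = a} with hG
  set S' : Finset (Fin c → A) := {x ∈ S | ¬ x i = a} with hS'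
  have hss : S' ⊂ S := by
    refine (filter_subset _ _).ssubset_of_ne ?_
    intro h
    obtain ⟨x, hx⟩ := hne
    have hx' := mem_filter.1 hx
    have := h ▸ hx'.1
    exact (mem_filter.1 this).2 hx'.2
  have hGS : #G + #S' = #S := card_filter_add_card_filter_not _
  obtain ⟨Good', hinv, hbad, hsum⟩ := ih S' hss (by omega) (fun h => hq (hss.1 h))
  have hpG := hp G (hcard.trans (by gcongr))
  set Gd : Finset (Fin c → A → (Fin b → ZMod 2)) :=
    {T | ∃ y, d < #{x ∈ G | tabHash T x = y}} with hGd
  have hfresh : ∀ i a v, a ≠ q i → (∀ x ∈ S, x i ≠ a) → ∀ T x, x ∈ S →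
      tabHash (T + eTab i a v : Fin c → A → (Fin b → ZMod 2)) x = tabHash T x := by
    intro i a v _ h T x hx
    rw [tabHash_add, tabHash_eTab, if_neg (h x hx), add_zero]
  have hhG : ∀ v T x, x ∈ G →
      tabHash (T + eTab i a v : Fin c → A → (Fin b → ZMod 2)) x = tabHash T x + v := by
    intro v T x hx
    rw [tabHash_add, tabHash_eTab, if_pos (mem_filter.1 hx).2]
  have hhS' : ∀ v T x, x ∈ S' →
      tabHash (T + eTab i a v : Fin c → A → (Fin b → ZMod 2)) x = tabHash T x := by
    intro v T x hx
    rw [tabHash_add, tabHash_eTab, if_neg (mem_filter.1 hx).2, add_zero]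
  have hhq : ∀ v T,
      tabHash (T + eTab i a v : Fin c → A → (Fin b → ZMod 2)) q = tabHash T q := by
    intro v T
    rw [tabHash_add, tabHash_eTab, if_neg haq.symm, add_zero]
  refine ⟨Good' \ Gd, ?_, ?_, ?_⟩
  · intro j a' v ha' hx T
    rw [mem_sdiff, mem_sdiff, hinv j a' v ha' (fun x hxS => hx x (hss.1 hxS))]
    have : T + eTab j a' v ∈ Gd ↔ T ∈ Gd := by
      simp only [hGd, mem_filter, mem_univ, true_and]
      have : ∀ y, ({x ∈ G | tabHash (T + eTab j a' v) x = y} : Finset _) =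
          {x ∈ G | tabHash T x = y} := by
        intro y
        apply filter_congr
        intro x hxG
        rw [hfresh j a' v ha' hx T x (mem_filter.1 hxG).1]
      simp only [this]
    rw [this]
  · have h1 : (Good' \ Gd)ᶜ ⊆ Good'ᶜ ∪ Gd := by
      intro T; simp only [mem_compl, mem_sdiff, mem_union]; tauto
    have h2 : (#(Good' \ Gd)ᶜ : ℝ) ≤ #Good'ᶜ + #Gd := by
      exact_mod_cast (card_le_card h1).trans (card_union_le _ _)
    have h3 : (1 : ℝ) ≤ #G := by exact_mod_cast hne.card_pos
    have h4 : (#S : ℝ) = #G + #S' := by exact_mod_cast hGS.symm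
    rw [h4]
    have h5 : 0 ≤ p * Fintype.card (Fin c → A → (Fin b → ZMod 2)) := by positivity
    nlinarith
  · have hm : (0 : ℝ) < 2 ^ b := by positivity
    have hd' : (0 : ℝ) < d := by exact_mod_cast hd
    have hw0 : 0 < w := by linarith
    -- pointwise bound
    have key : ∀ T, ∑ v, (if T + eTab i a v ∈ Good' \ Gd then
          w ^ ((#{x ∈ S | tabHash (T + eTab i a v) x = F (tabHash (T + eTab i a v) q)} : ℝ) / d)
          else 0) ≤
        if T ∈ Good' then w ^ ((#{x ∈ S' | tabHash T x = F (tabHash T q)} : ℝ) / d) *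
          (2 ^ b + (w - 1) / d * #G) else 0 := by
      intro T
      have hmem : ∀ v, T + eTab i a v ∈ Good' ↔ T ∈ Good' := fun v =>
        hinv i a v haq (fun x hx => (mem_filter.1 hx).2) T
      by_cases hT : T ∈ Good'
      swap
      · simp [hmem, hT]
      rw [if_pos hT]
      calc _ ≤ ∑ v, w ^ ((#{x ∈ S' | tabHash T x = F (tabHash T q)} : ℝ) / d) *
              (1 + (w - 1) / d * #{x ∈ G | tabHash T x + v = F (tabHash T q)}) := by
            apply sum_le_sum
            intro v _
            split_ifs with hv
            · have hb := (mem_sdiff.1 hv).2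
              simp only [hGd, mem_filter, mem_univ, true_and, not_exists, not_lt] at hb
              have hb := hb (F (tabHash T q))
              have e1 : ({x ∈ G | tabHash (T + eTab i a v) x = F (tabHash T q)} : Finset _) =
                  {x ∈ G | tabHash T x + v = F (tabHash T q)} :=
                filter_congr (fun x hx => by rw [hhG v T x hx])
              have e2 : ({x ∈ S' | tabHash (T + eTab i a v) x = F (tabHash T q)} : Finset _) =
                  {x ∈ S' | tabHash T x = F (tabHash T q)} :=
                filter_congr (fun x hx => by rw [hhS' v T x hx])
              have e3 : #{x ∈ S | tabHash (T + eTab i a v) x = F (tabHash T q)} =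
                  #{x ∈ S' | tabHash (T + eTab i a v) x = F (tabHash T q)} +
                  #{x ∈ G | tabHash (T + eTab i a v) x = F (tabHash T q)} := by
                have := card_filter_add_card_filter_not (s :=
                  ({x ∈ S | tabHash (T + eTab i a v) x = F (tabHash T q)} : Finset _))
                  (fun x => x i = a)
                rw [hS', hG, filter_comm, filter_comm (fun x : Fin c → A => x i = a)]
                omega
              rw [hhq, e3, e2, e1]
              rw [e1] at hb
              push_cast
              rw [add_div, Real.rpow_add hw0]
              gcongr
              exact bern w hw d _ hd hb
            · have : 0 ≤ w - 1 := by linarith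
              positivity
        _ = _ := by
            rw [← mul_sum, sum_add_distrib, ← mul_sum, sum_shift]
            simp only [sum_const, Finset.card_univ, card_V, nsmul_eq_mul]
            push_cast
            ring
    have h1 := avg i a (fun T => if T ∈ Good' \ Gd then
          w ^ ((#{x ∈ S | tabHash T x = F (tabHash T q)} : ℝ) / d) else 0)
    have h2 := h1.le.trans (sum_le_sum (fun T _ => key T))
    rw [← sum_filter, ← sum_filter, filter_mem_eq_inter, filter_mem_eq_inter, univ_inter,
      univ_inter, ← sum_mul] at h2
    have h4 : (#S : ℝ) = #G + #S' := by exact_mod_cast hGS.symm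
    have h0 : 0 ≤ (w - 1) / d := div_nonneg (by linarith) hd'.le
    have h5 : (2 : ℝ) ^ b + (w - 1) / d * #G ≤
        2 ^ b * Real.exp ((w - 1) / d * (#G / 2 ^ b)) := by
      have := Real.add_one_le_exp ((w - 1) / d * (#G / 2 ^ b))
      calc (2 : ℝ) ^ b + (w - 1) / d * #G = 2 ^ b * ((w - 1) / d * (#G / 2 ^ b) + 1) := by
            field_simp
            ring
        _ ≤ _ := by gcongr
    have h6 : (2 : ℝ) ^ b * ∑ T ∈ Good' \ Gd,
          w ^ ((#{x ∈ S | tabHash T x = F (tabHash T q)} : ℝ) / d) ≤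
        2 ^ b * (Fintype.card (Fin c → A → (Fin b → ZMod 2)) *
          Real.exp ((w - 1) / d * (#S / 2 ^ b))) := by
      refine h2.trans ((mul_le_mul hsum h5 (by positivity) (by positivity)).trans (le_of_eq ?_))
      rw [h4, add_div, mul_add, Real.exp_add]
      ring
    exact le_of_mul_le_mul_left h6 hm

lemma analytic (δ₀ : ℝ) (h0 : 0 < δ₀) : ∃ a : ℝ, 0 < a ∧ ∀ δ, δ₀ ≤ δ →
    δ - (1 + δ) * Real.log (1 + δ) ≤ -(a * (1 + δ) * Real.log (1 + δ)) := by
  have hu₀ : 0 < Real.log (1 + δ₀) := Real.log_pos (by linarith)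
  set u₀ := Real.log (1 + δ₀) with hu
  refine ⟨1 - (1 - Real.exp (-u₀)) / u₀, ?_, ?_⟩
  · have := Real.add_one_lt_exp (x := -u₀) (by linarith)
    rw [sub_pos, div_lt_one hu₀]
    linarith
  · intro δ hδ
    have hδ1 : 0 < 1 + δ := by linarith
    have huu : u₀ ≤ Real.log (1 + δ) := Real.log_le_log (by linarith) (by linarith)
    set u := Real.log (1 + δ) with hu'
    have hupos : 0 < u := by linarith
    have he : Real.exp (-u) = 1 / (1 + δ) := by
      rw [Real.exp_neg, hu', Real.exp_log hδ1, one_div]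
    have hb := rpow_one_add_le_one_add_mul_self (s := Real.exp (-u) - 1)
      (by linarith [Real.exp_pos (-u)]) (p := u₀ / u) (by positivity)
      ((div_le_one hupos).2 huu)
    rw [add_sub_cancel, ← Real.exp_mul] at hb
    have e1 : -u * (u₀ / u) = -u₀ := by field_simp
    rw [e1, he] at hb
    have e2 : u₀ / u * (1 / (1 + δ) - 1) = - (u₀ * δ / (u * (1 + δ))) := by
      field_simp
      ring
    rw [e2] at hb
    have h3 : u₀ * δ / (u * (1 + δ)) ≤ 1 - Real.exp (-u₀) := by linarith
    rw [div_le_iff₀ (by positivity)] at h3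
    have h4 : δ ≤ (1 - Real.exp (-u₀)) / u₀ * (u * (1 + δ)) := by
      rw [div_mul_eq_mul_div, le_div_iff₀ hu₀]
      linarith
    nlinarith

lemma hyp_nat (k N m : ℕ)
    (h : (m : ℝ) ≥ (N : ℝ) ^ ((1 : ℝ) - 1 / (2 * ((k + 1 : ℕ) : ℝ)))) :
    N ^ (2 * k + 1) ≤ m ^ (2 * k + 2) := by
  have h1 : ((N : ℝ) ^ ((1 : ℝ) - 1 / (2 * ((k + 1 : ℕ) : ℝ)))) ^ (2 * k + 2) ≤
      (m : ℝ) ^ (2 * k + 2) := by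
    gcongr
  rw [← Real.rpow_natCast ((N : ℝ) ^ _), ← Real.rpow_mul (by positivity)] at h1
  have e : ((1 : ℝ) - 1 / (2 * ((k + 1 : ℕ) : ℝ))) * ((2 * k + 2 : ℕ) : ℝ) =
      ((2 * k + 1 : ℕ) : ℝ) := by
    push_cast
    field_simp
    ring
  rw [e, Real.rpow_natCast] at h1
  exact_mod_cast h1

lemma N_le (k N m : ℕ) (hm : 1 ≤ m) (h : N ^ (2 * k + 1) ≤ m ^ (2 * k + 2)) : N ≤ m ^ 2 := by
  have h1 : N ^ (2 * k + 1) ≤ (m ^ 2) ^ (2 * k + 1) := by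
    rw [← pow_mul]
    exact h.trans (Nat.pow_le_pow_right hm (by omega))
  exact (Nat.pow_le_pow_iff_left (by omega)).1 h1

lemma G_le (k N m s : ℕ) (h : N ^ (2 * k + 1) ≤ m ^ (2 * k + 2)) (G : ℕ)
    (hG : G ^ (k + 1) ≤ 2 ^ (k + 1) * N ^ k) :
    G ^ ((2 * k + 1) * s) ≤ 2 ^ ((2 * k + 1) * s) * m ^ (2 * k * s) := by
  have h1 : (G ^ (2 * k + 1)) ^ (k + 1) ≤ (2 ^ (2 * k + 1) * m ^ (2 * k)) ^ (k + 1) := by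
    calc (G ^ (2 * k + 1)) ^ (k + 1) = (G ^ (k + 1)) ^ (2 * k + 1) := by ring
      _ ≤ (2 ^ (k + 1) * N ^ k) ^ (2 * k + 1) := by gcongr
      _ = (2 ^ (k + 1)) ^ (2 * k + 1) * (N ^ (2 * k + 1)) ^ k := by
          rw [mul_pow]; congr 1; rw [← pow_mul, ← pow_mul, mul_comm]
      _ ≤ (2 ^ (k + 1)) ^ (2 * k + 1) * (m ^ (2 * k + 2)) ^ k := by gcongr
      _ = _ := by
          rw [mul_pow, ← pow_mul, ← pow_mul, ← pow_mul, ← pow_mul]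
          congr 2 <;> ring
  have h2 := (Nat.pow_le_pow_iff_left (by omega)).1 h1
  calc G ^ ((2 * k + 1) * s) = (G ^ (2 * k + 1)) ^ s := by rw [pow_mul]
    _ ≤ (2 ^ (2 * k + 1) * m ^ (2 * k)) ^ s := by gcongr
    _ = _ := by rw [mul_pow, ← pow_mul, ← pow_mul]

end aux

/-- Chernoff-type concentration for simple tabulation, query-dependent bin,
upper tail for relative deviation `δ ≥ δ₀`. -/
theorem simple_tabulation_chernoff_large_delta :
    ∀ c : ℕ, 1 ≤ c → ∀ γ : ℝ, 0 < γ → ∀ δ₀ : ℝ, 0 < δ₀ →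
    ∃ a C : ℝ, 0 < a ∧ 0 < C ∧
      ∀ (A : Type) [Fintype A] (b : ℕ) (S : Finset (Fin c → A)) (q : Fin c → A)
        (F : (Fin b → ZMod 2) → (Fin b → ZMod 2)),
        q ∉ S →
        ((2 : ℝ) ^ b) ≥ (S.card : ℝ) ^ ((1 : ℝ) - 1 / (2 * (c : ℝ))) →
        ∀ δ : ℝ, δ₀ ≤ δ →
          tabPr c b A (fun T =>
              ((S.filter (fun x => tabHash T x = F (tabHash T q))).card : ℝ) >
                (1 + δ) * ((S.card : ℝ) / 2 ^ b)) ≤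
            (1 + δ) ^ (-(a * (1 + δ) * ((S.card : ℝ) / 2 ^ b))) +
              C * ((2 : ℝ) ^ b) ^ (-γ) := by
  intro c hc γ hγ δ₀ hδ₀
  obtain ⟨k, rfl⟩ : ∃ k, c = k + 1 := ⟨c - 1, by omega⟩
  obtain ⟨a, ha, hana⟩ := analytic δ₀ hδ₀
  obtain ⟨s, hs⟩ : ∃ s : ℕ, s = ⌈γ⌉₊ + 3 := ⟨_, rfl⟩
  obtain ⟨t, ht⟩ : ∃ t, t + 1 = (2 * k + 1) * s :=
    ⟨(2 * k + 1) * s - 1, Nat.sub_add_cancel (Nat.mul_pos (by omega) (by omega))⟩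
  have ht0 : 0 < t := by
    have : s ≤ (2 * k + 1) * s := Nat.le_mul_of_pos_left s (by omega)
    omega
  obtain ⟨d, hd⟩ : ∃ d, d = t ^ (k + 1) := ⟨_, rfl⟩
  have hd0 : 0 < d := hd ▸ Nat.pow_pos ht0
  have hd' : (0 : ℝ) < d := by exact_mod_cast hd0
  refine ⟨a / d, (k + 1) * 2 ^ (t + 1), by positivity, by positivity, ?_⟩
  intro A _ b S q F hq hm δ hδ
  classical
  obtain ⟨m, hmdef⟩ : ∃ m : ℕ, m = 2 ^ b := ⟨_, rfl⟩
  have hmR : (2 : ℝ) ^ b = m := by rw [hmdef]; push_cast; rfl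
  have hm1 : 1 ≤ m := hmdef ▸ Nat.one_le_two_pow
  have hmpos : (0 : ℝ) < m := by exact_mod_cast hm1
  have hNm : #S ^ (2 * k + 1) ≤ m ^ (2 * k + 2) := hyp_nat k _ m (hmR ▸ hm)
  have hN2 := N_le k _ m hm1 hNm
  obtain ⟨p, hp⟩ : ∃ p : ℝ, p = (k + 1) * 2 ^ (t + 1) * m / m ^ s := ⟨_, rfl⟩
  have hp0 : 0 ≤ p := by rw [hp]; positivity
  have hbound : ∀ G : Finset (Fin (k + 1) → A), #G ^ (k + 1) ≤ 2 ^ (k + 1) * #S ^ (k + 1 - 1) →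
      (#{T : Fin (k + 1) → A → (Fin b → ZMod 2) | ∃ y, d < #{x ∈ G | tabHash T x = y}} : ℝ) ≤
        p * Fintype.card (Fin (k + 1) → A → (Fin b → ZMod 2)) := by
    intro G hG
    have h1 := bounded_lemma (b := b) t G
    have h2 := G_le k #S m s hNm #G hG
    rw [← hd, ht, ← hmdef] at h1
    set Bd := #{T : Fin (k + 1) → A → (Fin b → ZMod 2) | ∃ y, d < #{x ∈ G | tabHash T x = y}}
    set Om := Fintype.card (Fin (k + 1) → A → (Fin b → ZMod 2))
    have h3 : m ^ (2 * k * s) * (m ^ s * Bd) ≤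
        m ^ (2 * k * s) * ((k + 1) * 2 ^ (t + 1) * m * Om) := by
      calc m ^ (2 * k * s) * (m ^ s * Bd) = m ^ ((2 * k + 1) * s) * Bd := by ring
        _ = m * (m ^ t * Bd) := by rw [← ht]; ring
        _ ≤ m * ((k + 1) * (2 ^ ((2 * k + 1) * s) * m ^ (2 * k * s)) * Om) := by
            exact Nat.mul_le_mul_left _ (h1.trans (by gcongr))
        _ = _ := by rw [← ht]; ring
    have h4 := Nat.le_of_mul_le_mul_left h3 (by positivity)
    have h5 : (m : ℝ) ^ s * Bd ≤ (k + 1) * 2 ^ (t + 1) * m * Om := by exact_mod_cast h4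
    rw [hp, div_mul_eq_mul_div, le_div_iff₀ (by positivity)]
    linarith
  obtain ⟨Good, -, hbad, hsum⟩ := mgf q F (1 + δ) (by linarith) d hd0 p hp0 #S hbound S le_rfl hq
  have hδ1 : 0 < 1 + δ := by linarith
  unfold tabPr
  rw [Nat.card_eq_fintype_card, Nat.card_eq_fintype_card, Fintype.card_subtype]
  set Om := Fintype.card (Fin (k + 1) → A → (Fin b → ZMod 2)) with hOm
  have hOm0 : (0 : ℝ) < Om := by exact_mod_cast Fintype.card_pos
  set E : Finset (Fin (k + 1) → A → (Fin b → ZMod 2)) :=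
    {T | ((S.filter (fun x => tabHash T x = F (tabHash T q))).card : ℝ) >
                (1 + δ) * ((S.card : ℝ) / 2 ^ b)} with hE
  obtain ⟨μ, hμ⟩ : ∃ μ : ℝ, μ = (#S : ℝ) / 2 ^ b := ⟨_, rfl⟩
  have hμ0 : 0 ≤ μ := by rw [hμ]; positivity
  rw [← hμ] at hsum hE ⊢
  have hEsplit : (#E : ℝ) ≤ #Goodᶜ + #(Good ∩ E) := by
    have : E ⊆ Goodᶜ ∪ (Good ∩ E) := by
      intro T; simp only [mem_union, mem_compl, mem_inter]; tauto
    exact_mod_cast (card_le_card this).trans (card_union_le _ _)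
  have hmark : #(Good ∩ E) * (1 + δ) ^ ((1 + δ) * μ / d) ≤ Om * Real.exp (δ / d * μ) := by
    have e : (1 + δ - 1) / (d : ℝ) * μ = δ / d * μ := by ring
    rw [e] at hsum
    refine le_trans ?_ hsum
    rw [← nsmul_eq_mul, ← sum_const]
    refine le_trans (sum_le_sum ?_)
      (sum_le_sum_of_subset_of_nonneg (inter_subset_left (s₂ := E)) ?_)
    · intro T hT
      have hTE := (mem_inter.1 hT).2
      rw [hE, mem_filter] at hTE
      apply Real.rpow_le_rpow_of_exponent_le (by linarith)
      gcongr
      exact hTE.2.le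
    · intro T _ _
      positivity
  have hfin1 : (#(Good ∩ E) : ℝ) ≤ Om * (1 + δ) ^ (-(a / d * (1 + δ) * μ)) := by
    have hpos : 0 < (1 + δ) ^ ((1 + δ) * μ / d) := Real.rpow_pos_of_pos hδ1 _
    refine le_of_mul_le_mul_right (hmark.trans ?_) hpos
    rw [mul_assoc, ← Real.rpow_add hδ1, Real.rpow_def_of_pos hδ1]
    refine mul_le_mul_of_nonneg_left (Real.exp_le_exp.2 ?_) hOm0.le
    have h1 := mul_le_mul_of_nonneg_right (hana δ hδ) (show 0 ≤ μ / d by positivity)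
    have e : Real.log (1 + δ) * (-(a / d * (1 + δ) * μ) + (1 + δ) * μ / d) =
      (-(a * (1 + δ) * Real.log (1 + δ)) + (1 + δ) * Real.log (1 + δ)) * (μ / d) := by ring
    rw [e]
    have e2 : δ / d * μ = δ * (μ / d) := by ring
    rw [e2]
    linarith
  have hfin2 : (#S : ℝ) * p ≤ (k + 1) * 2 ^ (t + 1) * (m : ℝ) ^ (-γ) := by
    have hN2' : (#S : ℝ) ≤ m ^ 2 := by exact_mod_cast hN2
    have h1 : ((m : ℝ) ^ ⌈γ⌉₊)⁻¹ ≤ (m : ℝ) ^ (-γ) := by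
      rw [Real.rpow_neg hmpos.le, ← Real.rpow_natCast]
      gcongr
      · exact_mod_cast hm1
      · exact Nat.le_ceil γ
    calc (#S : ℝ) * p ≤ m ^ 2 * p := by gcongr
      _ = (k + 1) * 2 ^ (t + 1) * ((m : ℝ) ^ ⌈γ⌉₊)⁻¹ := by
          rw [hp, hs, pow_add]
          field_simp
          ring
      _ ≤ _ := by gcongr
  rw [div_le_iff₀ hOm0, hmR]
  calc (#E : ℝ) ≤ #Goodᶜ + #(Good ∩ E) := hEsplit
    _ ≤ #S * p * Om + Om * (1 + δ) ^ (-(a / d * (1 + δ) * μ)) := add_le_add hbad hfin1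
    _ ≤ ((k + 1) * 2 ^ (t + 1) * (m : ℝ) ^ (-γ)) * Om +
        Om * (1 + δ) ^ (-(a / d * (1 + δ) * μ)) := by gcongr
    _ = _ := by ring
end

section
/- For every number of characters c ≥ 1 and every constant γ > 0 there exists a constant C > 0 (depending only on c and γ) such that the following holds. Let Σ be a finite alphabet, let m = 2^b, and let S ⊆ Σ^c be a set of n ≥ 2 keys with m ≤ n. Hash by a random simple tabulation hash function h into m bins. Then with probability at least 1 − n^{−γ}, every bin B ∈ (ZMod 2)^b satisfies | |{x ∈ S : h(x) = B}| − n/m | ≤ C·√(n/m)·(log₂ n)^c. -/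
open Finset

def cnt {c : ℕ} {A G : Type} [AddCommGroup G] [DecidableEq G] (T : Fin c → A → G)
    (S : Finset (Fin c → A)) (g : G) : ℕ := (S.filter fun x => ∑ i, T i (x i) = g).card

def tslice {c : ℕ} {A : Type} [Fintype A] [DecidableEq A] (S : Finset (Fin (c+1) → A)) (a : A) :
    Finset (Fin c → A) := univ.filter fun x => (Fin.cons a x : Fin (c+1) → A) ∈ S

lemma sum_slice {c : ℕ} {A : Type} [Fintype A] [DecidableEq A] (S : Finset (Fin (c+1) → A)) :
    ∑ a, (tslice S a).card = S.card := by
  have h : S.card = ∑ x : Fin (c+1) → A, if x ∈ S then 1 else 0 := by simp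
  rw [h, ← (Fin.consEquiv (fun _ : Fin (c+1) => A)).sum_comp, Fintype.sum_prod_type]
  refine Finset.sum_congr rfl fun a _ => ?_
  rw [tslice, card_filter]
  rfl

lemma cnt_eq {c : ℕ} {A G : Type} [AddCommGroup G] [DecidableEq G] [Fintype A] [DecidableEq A]
    (T0 : A → G) (T : Fin c → A → G) (S : Finset (Fin (c+1) → A)) (g : G) :
    cnt (Fin.cons T0 T : Fin (c+1) → A → G) S g = ∑ a, cnt T (tslice S a) (g - T0 a) := by
  have h : cnt (Fin.cons T0 T : Fin (c+1) → A → G) S g = ∑ x : Fin (c+1) → A,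
      if (x ∈ S ∧ ∑ i, (Fin.cons T0 T : Fin (c+1) → A → G) i (x i) = g) then 1 else 0 := by
    rw [← card_filter, cnt]; congr 1; ext x; simp
  rw [h, ← (Fin.consEquiv (fun _ : Fin (c+1) => A)).sum_comp, Fintype.sum_prod_type]
  refine Finset.sum_congr rfl fun a _ => ?_
  rw [← card_filter, cnt]; congr 1; ext x
  simp [tslice, Fin.sum_univ_succ, Fin.consEquiv, eq_sub_iff_add_eq']

lemma sum_cnt {c : ℕ} {A G : Type} [AddCommGroup G] [DecidableEq G] [Fintype G]
    (T : Fin c → A → G) (S : Finset (Fin c → A)) : ∑ g, cnt T S g = S.card := by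
  unfold cnt
  exact (card_eq_sum_card_fiberwise (fun _ _ => Finset.mem_coe.2 (mem_univ _))).symm

open scoped Classical in
lemma chernoff {A G : Type} [Fintype A] [DecidableEq A] [Fintype G] (F : A → G → ℝ)
    (h1 : ∀ a g, |F a g| ≤ 1) (h0 : ∀ a, ∑ g, F a g = 0)
    (h2 : ∑ a, ∑ g, F a g ^ 2 ≤ 2 * Fintype.card G) [Nonempty G] (s : ℝ) :
    ((univ.filter fun T : A → G => s < ∑ a, F a (T a)).card : ℝ)
      ≤ Real.exp (2 - s) * Fintype.card (A → G) := by
  have hm : (0:ℝ) < Fintype.card G := by exact_mod_cast Fintype.card_pos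
  have e1 : ∑ T : A → G, Real.exp (∑ a, F a (T a)) ≤ Real.exp 2 * Fintype.card (A → G) := by
    have : ∑ T : A → G, Real.exp (∑ a, F a (T a)) = ∏ a, ∑ g, Real.exp (F a g) := by
      rw [Finset.prod_univ_sum, Fintype.piFinset_univ]
      simp_rw [Real.exp_sum]
    rw [this]
    calc ∏ a, ∑ g, Real.exp (F a g)
        ≤ ∏ a, (Real.exp ((∑ g, F a g ^ 2) / Fintype.card G) * Fintype.card G) := by
          refine Finset.prod_le_prod (fun _ _ => by positivity) fun a _ => ?_
          calc ∑ g, Real.exp (F a g) ≤ ∑ g, (1 + F a g + F a g ^ 2) := by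
                refine Finset.sum_le_sum fun g _ => ?_
                have := (abs_le.1 (Real.abs_exp_sub_one_sub_id_le (h1 a g))).2
                linarith
            _ = ((∑ g, F a g ^ 2) / Fintype.card G + 1) * Fintype.card G := by
                rw [sum_add_distrib, sum_add_distrib, h0]
                simp
                field_simp
                ring
            _ ≤ _ := by gcongr; exact Real.add_one_le_exp _
      _ = Real.exp ((∑ a, ∑ g, F a g ^ 2) / Fintype.card G) * Fintype.card (A → G) := by
          rw [prod_mul_distrib, ← Real.exp_sum, ← Finset.sum_div]
          simp
      _ ≤ _ := by
          gcongr
          rw [div_le_iff₀ hm]; exact h2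
  have e2 : Real.exp s * ((univ.filter fun T : A → G => s < ∑ a, F a (T a)).card : ℝ)
      ≤ ∑ T : A → G, Real.exp (∑ a, F a (T a)) := by
    calc _ = ∑ T ∈ univ.filter (fun T : A → G => s < ∑ a, F a (T a)), Real.exp s := by
          simp [mul_comm]
      _ ≤ ∑ T ∈ univ.filter (fun T : A → G => s < ∑ a, F a (T a)), Real.exp (∑ a, F a (T a)) := by
          refine Finset.sum_le_sum fun T hT => ?_
          exact Real.exp_le_exp.2 (mem_filter.1 hT).2.le
      _ ≤ _ := Finset.sum_le_sum_of_subset_of_nonneg (filter_subset _ _)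
          fun _ _ _ => (Real.exp_pos _).le
  have e3 := e2.trans e1
  rw [Real.exp_sub, div_mul_eq_mul_div, le_div_iff₀ (Real.exp_pos _)]
  linarith

open scoped Classical in
lemma chernoff2 {A G : Type} [Fintype A] [DecidableEq A] [Fintype G] (F : A → G → ℝ)
    (h1 : ∀ a g, |F a g| ≤ 1) (h0 : ∀ a, ∑ g, F a g = 0)
    (h2 : ∑ a, ∑ g, F a g ^ 2 ≤ 2 * Fintype.card G) [Nonempty G] (s : ℝ) :
    ((univ.filter fun T : A → G => s < |∑ a, F a (T a)|).card : ℝ)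
      ≤ 2 * Real.exp (2 - s) * Fintype.card (A → G) := by
  have k1 := chernoff F h1 h0 h2 s
  have k2 := chernoff (fun a g => - F a g) (by simpa using h1) (by simpa using h0)
    (by simpa using h2) s
  have : (univ.filter fun T : A → G => s < |∑ a, F a (T a)|) ⊆
    (univ.filter fun T : A → G => s < ∑ a, F a (T a)) ∪
    (univ.filter fun T : A → G => s < ∑ a, - F a (T a)) := by
    intro T
    simp [lt_abs]
  have := (card_le_card this).trans (card_union_le _ _)
  have : ((univ.filter fun T : A → G => s < |∑ a, F a (T a)|).card : ℝ) ≤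
    ((univ.filter fun T : A → G => s < ∑ a, F a (T a)).card : ℝ) +
    ((univ.filter fun T : A → G => s < ∑ a, - F a (T a)).card : ℝ) := by exact_mod_cast this
  linarith

/-- `|load - n/m|` exceeds `K`. -/
def Bad {c : ℕ} {A G : Type} [AddCommGroup G] [DecidableEq G] [Fintype G] (K : ℝ)
    (S : Finset (Fin c → A)) (T : Fin c → A → G) (g : G) : Prop :=
  K * √(max 1 ((S.card : ℝ) / (Fintype.card G : ℝ))) <
    |(cnt T S g : ℝ) - (S.card : ℝ) / (Fintype.card G : ℝ)|

open scoped Classical in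
lemma step2 {c : ℕ} {A G : Type} [AddCommGroup G] [DecidableEq G] [Fintype G] [Fintype A]
    [DecidableEq A] (S : Finset (Fin (c+1) → A)) (T : Fin c → A → G) (K : ℝ) (hK : 1 ≤ K)
    (hT : ∀ a g, ¬ Bad K (tslice S a) T g) (g : G) (s : ℝ) :
    ((univ.filter fun T0 : A → G => Bad (K * s) S (Fin.cons T0 T : Fin (c+1) → A → G) g).card : ℝ)
      ≤ 2 * Real.exp (2 - s) * Fintype.card (A → G) := by
  have hm : (0:ℝ) < Fintype.card G := by exact_mod_cast Fintype.card_pos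
  set m : ℝ := (Fintype.card G : ℝ) with hmdef
  set R := √(max 1 ((S.card : ℝ) / m)) with hR
  have hR1 : 1 ≤ R := by rw [hR, Real.one_le_sqrt]; exact le_max_left _ _
  have hR2 : R ^ 2 = max 1 ((S.card : ℝ) / m) := Real.sq_sqrt (by positivity)
  have hKR : 0 < K * R := by positivity
  set D : A → G → ℝ := fun a y => (cnt T (tslice S a) (g - y) : ℝ) - (tslice S a).card / m with hD
  have hD1 : ∀ a y, |D a y| ≤ K * √(max 1 (((tslice S a).card : ℝ) / m)) := fun a y =>
    not_lt.1 (hT a (g - y))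
  have hle : ∀ a, ((tslice S a).card : ℝ) ≤ S.card := fun a => by
    have := sum_slice S
    exact_mod_cast this ▸ Finset.single_le_sum (f := fun a => (tslice S a).card)
      (fun _ _ => Nat.zero_le _) (mem_univ a)
  have hsum : ∀ a, ∑ y, (cnt T (tslice S a) (g - y) : ℝ) = (tslice S a).card := fun a => by
    refine ((Equiv.subLeft g).sum_comp (fun y => (cnt T (tslice S a) y : ℝ))).trans ?_
    exact_mod_cast sum_cnt T (tslice S a)
  have hD0 : ∀ a, ∑ y, D a y = 0 := fun a => by
    simp only [hD, sum_sub_distrib, hsum]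
    simp [← hmdef]; field_simp; ring
  have hD2 : ∀ a, ∑ y, D a y ^ 2 ≤ 2 * K ^ 2 * (tslice S a).card := by
    intro a
    rcases le_total 1 (((tslice S a).card : ℝ) / m) with h | h
    · calc ∑ y, D a y ^ 2 ≤ ∑ y : G, K ^ 2 * (((tslice S a).card : ℝ) / m) := by
            refine sum_le_sum fun y _ => ?_
            have := hD1 a y
            rw [max_eq_right h] at this
            have := pow_le_pow_left₀ (abs_nonneg _) this 2
            rwa [sq_abs, mul_pow, Real.sq_sqrt (by positivity)] at this
        _ = K ^ 2 * (tslice S a).card := by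
            simp [← hmdef]; field_simp
        _ ≤ _ := by nlinarith [show 0 ≤ K ^ 2 * ((tslice S a).card : ℝ) by positivity]
    · have hc : ∀ y, (cnt T (tslice S a) (g - y) : ℝ) ≤ 2 * K := fun y => by
        have := hD1 a y
        rw [max_eq_left h, Real.sqrt_one] at this
        have := (abs_le.1 this).2
        simp only [hD] at this
        linarith
      calc ∑ y, D a y ^ 2 = ∑ y, ((cnt T (tslice S a) (g - y) : ℝ) ^ 2
              - ((tslice S a).card / m) * (2 * D a y + (tslice S a).card / m)) := by
            refine sum_congr rfl fun y _ => ?_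
            simp only [hD]; ring
        _ ≤ ∑ y, (cnt T (tslice S a) (g - y) : ℝ) ^ 2 := by
            rw [sum_sub_distrib, ← mul_sum, sum_add_distrib, ← mul_sum, hD0]
            have : 0 ≤ ((tslice S a).card / m : ℝ) * (2 * 0 + ∑ i : G, ((tslice S a).card / m : ℝ)) := by
              positivity
            linarith
        _ ≤ ∑ y, 2 * K * (cnt T (tslice S a) (g - y) : ℝ) := by
            refine sum_le_sum fun y _ => ?_
            rw [sq]; gcongr; exact hc y
        _ = 2 * K * (tslice S a).card := by rw [← mul_sum, hsum]
        _ ≤ _ := by gcongr; nlinarith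
  have key := chernoff2 (fun a y => D a y / (K * R)) (fun a y => by
      rw [abs_div, abs_of_pos hKR, div_le_one hKR]
      refine (hD1 a y).trans ?_
      rw [hR]
      gcongr
      exact_mod_cast hle a) (fun a => by rw [← sum_div, hD0, zero_div]) (by
      simp_rw [div_pow, ← sum_div]
      rw [div_le_iff₀ (by positivity)]
      calc ∑ a, ∑ y, D a y ^ 2 ≤ ∑ a, 2 * K ^ 2 * ((tslice S a).card : ℝ) :=
            sum_le_sum fun a _ => hD2 a
        _ = 2 * K ^ 2 * S.card := by
            rw [← mul_sum]; congr 1; exact_mod_cast sum_slice S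
        _ ≤ 2 * m * (K * R) ^ 2 := by
            rw [mul_pow, hR2]
            have : (S.card : ℝ) ≤ m * max 1 ((S.card : ℝ) / m) := by
              calc (S.card : ℝ) = m * ((S.card : ℝ) / m) := by field_simp
                _ ≤ _ := by gcongr; exact le_max_right _ _
            calc 2 * K ^ 2 * (S.card : ℝ) ≤ 2 * K ^ 2 * (m * max 1 ((S.card : ℝ) / m)) := by gcongr
              _ = _ := by ring) s
  refine le_trans ?_ key
  norm_cast
  refine card_le_card fun T0 h => ?_
  rw [mem_filter] at h ⊢
  refine ⟨mem_univ _, ?_⟩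
  have h := h.2
  rw [Bad, ← hmdef, ← hR, cnt_eq] at h
  rw [← sum_div, abs_div, abs_of_pos hKR, lt_div_iff₀ hKR]
  have : ((∑ a, cnt T (tslice S a) (g - T0 a) : ℕ) : ℝ) - S.card / m = ∑ a, D a (T0 a) := by
    simp only [hD, sum_sub_distrib, ← sum_div]
    rw [← sum_slice S]; push_cast; rfl
  rw [this] at h
  linarith

lemma numeric (γ : ℝ) (hγ : 0 < γ) (N : ℕ) (hN : 2 ≤ N) :
    (N : ℝ) * (N : ℝ) ^ (-(γ + 2)) +
     N * (2 * Real.exp (2 - (γ + 5) * Real.logb 2 N)) ≤ (N : ℝ) ^ (-γ) := by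
  have hN' : (2:ℝ) ≤ N := by exact_mod_cast hN
  have hN0 : (0:ℝ) < N := by linarith
  set L := Real.logb 2 N with hL
  have hL1 : 1 ≤ L := by
    rw [hL, Real.le_logb_iff_rpow_le (by norm_num) hN0]; simpa using hN'
  have hlog : Real.log N = L * Real.log 2 := by
    rw [hL, Real.logb]; field_simp
  have hl2 : Real.log 2 ≤ 1 := by linarith [Real.log_two_lt_d9]
  have hl0 : 0 < Real.log 2 := Real.log_pos (by norm_num)
  have hlL : Real.log N ≤ L := by rw [hlog]; nlinarith
  have a1 : (N : ℝ) * (N : ℝ) ^ (-(γ + 2)) = (N:ℝ) ^ (-γ) * (N:ℝ)⁻¹ := by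
    rw [← Real.rpow_neg_one, ← Real.rpow_add hN0]
    nth_rw 1 [← Real.rpow_one (N:ℝ)]
    rw [← Real.rpow_add hN0]; congr 1; ring
  have a2 : N * (2 * Real.exp (2 - (γ + 5) * L)) ≤ (N:ℝ) ^ (-γ) * (N:ℝ)⁻¹ := by
    rw [← Real.rpow_neg_one, ← Real.rpow_add hN0, Real.rpow_def_of_pos hN0]
    have h2 : (2:ℝ) ≤ Real.exp 1 := by linarith [Real.add_one_le_exp (1:ℝ)]
    calc N * (2 * Real.exp (2 - (γ + 5) * L))
        ≤ Real.exp L * (Real.exp 1 * Real.exp (2 - (γ + 5) * L)) := by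
          gcongr
          rw [← Real.log_le_iff_le_exp hN0]; exact hlL
      _ = Real.exp (L + (1 + (2 - (γ + 5) * L))) := by rw [Real.exp_add, Real.exp_add]
      _ ≤ _ := by
          apply Real.exp_le_exp.2
          nlinarith
  have a3 : (N:ℝ)⁻¹ ≤ 1/2 := by
    rw [one_div]; exact inv_anti₀ (by norm_num) hN'
  have : (0:ℝ) < (N:ℝ) ^ (-γ) := by positivity
  nlinarith

open scoped Classical in
lemma main (c : ℕ) : ∀ γ : ℝ, 0 < γ → ∃ C : ℝ, 1 ≤ C ∧
    ∀ (A G : Type) [Fintype A] [AddCommGroup G] [Fintype G] [DecidableEq G] (N : ℕ), 2 ≤ N →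
      Fintype.card G ≤ N → ∀ S : Finset (Fin c → A), S.card ≤ N →
      ((univ.filter fun T : Fin c → A → G =>
        ∃ g, Bad (C * (Real.logb 2 N) ^ c) S T g).card : ℝ) ≤
        (N : ℝ) ^ (-γ) * Fintype.card (Fin c → A → G) := by
  induction c with
  | zero =>
    intro γ hγ
    refine ⟨1, le_rfl, ?_⟩
    intro A G _ _ _ _ N hN hG S hS
    have : (univ.filter fun T : Fin 0 → A → G =>
        ∃ g, Bad (1 * (Real.logb 2 N) ^ 0) S T g) = ∅ := by
      rw [filter_eq_empty_iff]
      rintro T - ⟨g, hg⟩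
      rw [Bad, ← not_le] at hg
      apply hg
      have hm : (1:ℝ) ≤ Fintype.card G := by exact_mod_cast Fintype.card_pos
      have h1 : (S.card : ℝ) ≤ 1 := by
        have := S.card_le_univ; simp at this; exact_mod_cast this
      have h2 : (cnt T S g : ℝ) ≤ S.card := by exact_mod_cast card_filter_le _ _
      have h3 : (S.card : ℝ) / Fintype.card G ≤ 1 := by
        rw [div_le_one (by linarith)]; linarith
      have h4 : 0 ≤ (S.card : ℝ) / Fintype.card G := by positivity
      rw [max_eq_left h3]
      have h5 : 0 ≤ (cnt T S g : ℝ) := by positivity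
      simp only [pow_zero, Real.sqrt_one, mul_one]
      rw [abs_le]; constructor <;> linarith
    rw [this]; simp; positivity
  | succ c ih =>
    intro γ hγ
    obtain ⟨C, hC, ih⟩ := ih (γ + 2) (by linarith)
    refine ⟨C * (γ + 5), by nlinarith, ?_⟩
    intro A G _ _ _ _ N hN hG S hS
    have hN' : (2:ℝ) ≤ N := by exact_mod_cast hN
    have hN0 : (0:ℝ) < N := by linarith
    set L := Real.logb 2 N with hL
    have hL1 : 1 ≤ L := by
      rw [hL, Real.le_logb_iff_rpow_le (by norm_num) hN0]; simpa using hN'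
    set K := C * L ^ c with hKdef
    have hK : 1 ≤ K := one_le_mul_of_one_le_of_one_le hC (one_le_pow₀ hL1)
    set s := (γ + 5) * L with hs
    have hKs : C * (γ + 5) * L ^ (c+1) = K * s := by rw [hKdef, hs]; ring
    rw [hKs]
    -- transfer to product
    set Q : Finset ((A → G) × (Fin c → A → G)) := univ.filter fun p =>
      ∃ g, Bad (K * s) S (Fin.cons p.1 p.2 : Fin (c+1) → A → G) g with hQ
    have hcard : (univ.filter fun T : Fin (c+1) → A → G => ∃ g, Bad (K * s) S T g).card
        = Q.card := by
      rw [hQ, card_filter, card_filter,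
        ← (Fin.consEquiv (fun _ : Fin (c+1) => A → G)).sum_comp]
      rfl
    have htot : (Fintype.card (Fin (c+1) → A → G) : ℝ)
        = Fintype.card (A → G) * Fintype.card (Fin c → A → G) := by
      rw [← Fintype.card_congr (Fin.consEquiv (fun _ : Fin (c+1) => A → G)), Fintype.card_prod]
      push_cast; rfl
    rw [hcard, htot]
    set A' : Finset A := univ.filter fun a => (tslice S a).Nonempty with hA'
    have hA'N : (A'.card : ℝ) ≤ N := by
      have h1 : A'.card ≤ S.card := by
        rw [← sum_slice S, card_eq_sum_ones]
        calc ∑ a ∈ A', 1 ≤ ∑ a ∈ A', (tslice S a).card :=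
              sum_le_sum fun a ha => Finset.card_pos.2 (mem_filter.1 ha).2
          _ ≤ _ := sum_le_sum_of_subset (subset_univ _)
      exact_mod_cast h1.trans hS
    set Q1 : A → Finset ((A → G) × (Fin c → A → G)) := fun a =>
      univ ×ˢ univ.filter fun T => ∃ g, Bad K (tslice S a) T g with hQ1
    set Q2 : G → Finset ((A → G) × (Fin c → A → G)) := fun g =>
      univ.filter fun p => (∀ a g, ¬ Bad K (tslice S a) p.2 g) ∧
        Bad (K * s) S (Fin.cons p.1 p.2 : Fin (c+1) → A → G) g with hQ2
    have hsub : Q ⊆ A'.biUnion Q1 ∪ univ.biUnion Q2 := by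
      intro p hp
      obtain ⟨g, hg⟩ := (mem_filter.1 hp).2
      rw [mem_union]
      by_cases h : ∀ a g, ¬ Bad K (tslice S a) p.2 g
      · right
        rw [mem_biUnion]
        exact ⟨g, mem_univ _, mem_filter.2 ⟨mem_univ _, h, hg⟩⟩
      · left
        push Not at h
        obtain ⟨a, g', h⟩ := h
        rw [mem_biUnion]
        refine ⟨a, ?_, by simp only [hQ1, mem_product, mem_filter, mem_univ, true_and]; exact ⟨g', h⟩⟩
        rw [hA', mem_filter]
        refine ⟨mem_univ _, ?_⟩
        by_contra hne
        rw [not_nonempty_iff_eq_empty] at hne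
        rw [hne, Bad] at h
        simp [cnt] at h
        linarith
    have c1 : ∀ a, ((Q1 a).card : ℝ) ≤
        (N:ℝ) ^ (-(γ+2)) * (Fintype.card (A → G) * Fintype.card (Fin c → A → G)) := by
      intro a
      have hsl : (tslice S a).card ≤ N := by
        refine le_trans ?_ hS
        rw [← sum_slice S]
        exact Finset.single_le_sum (f := fun a => (tslice S a).card)
          (fun _ _ => Nat.zero_le _) (mem_univ a)
      have := ih A G N hN hG (tslice S a) hsl
      simp only [hQ1, card_product, Nat.cast_mul]
      rw [card_univ]
      calc _ ≤ (Fintype.card (A → G) : ℝ) * ((N:ℝ) ^ (-(γ+2)) * Fintype.card (Fin c → A → G)) := by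
            gcongr
        _ = _ := by ring
    have c2 : ∀ g, ((Q2 g).card : ℝ) ≤
        (2 * Real.exp (2 - s)) * (Fintype.card (A → G) * Fintype.card (Fin c → A → G)) := by
      intro g
      have : (Q2 g).card = ∑ T : Fin c → A → G, (univ.filter fun T0 : A → G =>
          (∀ a g, ¬ Bad K (tslice S a) T g) ∧
          Bad (K * s) S (Fin.cons T0 T : Fin (c+1) → A → G) g).card := by
        simp only [hQ2, card_filter]
        rw [Fintype.sum_prod_type_right]
      rw [this]; push_cast
      calc _ ≤ ∑ T : Fin c → A → G, 2 * Real.exp (2 - s) * Fintype.card (A → G) := by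
            refine sum_le_sum fun T _ => ?_
            by_cases h : ∀ a g, ¬ Bad K (tslice S a) T g
            · refine le_trans ?_ (step2 S T K hK h g s)
              norm_cast
              exact card_le_card fun T0 h => mem_filter.2 ⟨mem_univ _, (mem_filter.1 h).2.2⟩
            · rw [filter_false_of_mem (fun T0 _ h' => h h'.1)]
              simp; positivity
        _ = _ := by simp [sum_const]; ring
    set W : ℝ := Fintype.card (A → G) * Fintype.card (Fin c → A → G) with hW
    have hW0 : 0 ≤ W := by positivity
    have hQc : (Q.card : ℝ) ≤ ∑ a ∈ A', ((Q1 a).card : ℝ) + ∑ g, ((Q2 g).card : ℝ) := by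
      have := (card_le_card hsub).trans ((card_union_le _ _).trans
        (add_le_add card_biUnion_le card_biUnion_le))
      exact_mod_cast this
    have hGN : (Fintype.card G : ℝ) ≤ N := by exact_mod_cast hG
    calc (Q.card : ℝ) ≤ ∑ a ∈ A', (N:ℝ) ^ (-(γ+2)) * W + ∑ g : G, 2 * Real.exp (2 - s) * W :=
          hQc.trans (add_le_add (sum_le_sum fun a _ => c1 a) (sum_le_sum fun g _ => c2 g))
      _ = A'.card * ((N:ℝ) ^ (-(γ+2)) * W) + Fintype.card G * (2 * Real.exp (2 - s) * W) := by
          simp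
      _ ≤ N * ((N:ℝ) ^ (-(γ+2)) * W) + N * (2 * Real.exp (2 - s) * W) := by gcongr
      _ = (N * (N:ℝ) ^ (-(γ+2)) + N * (2 * Real.exp (2 - s))) * W := by ring
      _ ≤ _ := by gcongr; exact numeric γ hγ N hN

/-- With `m ≤ n` bins, with probability `1 - n^{-γ}` every bin gets
`n/m ± O(√(n/m) · log^c n)` keys under simple tabulation hashing. -/
theorem simple_tabulation_few_bins :
    ∀ c : ℕ, 1 ≤ c → ∀ γ : ℝ, 0 < γ →
    ∃ C : ℝ, 0 < C ∧
      ∀ (A : Type) [Fintype A] (b : ℕ) (S : Finset (Fin c → A)),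
        2 ≤ S.card → 2 ^ b ≤ S.card →
        tabPr c b A (fun T =>
            ∀ B : Fin b → ZMod 2,
              |((S.filter (fun x => tabHash T x = B)).card : ℝ) -
                  (S.card : ℝ) / 2 ^ b| ≤
                C * Real.sqrt ((S.card : ℝ) / 2 ^ b) * (Real.logb 2 (S.card : ℝ)) ^ c) ≥
          1 - (S.card : ℝ) ^ (-γ) := by

  classical
  intro c _ γ hγ
  obtain ⟨C, hC, h⟩ := main c γ hγ
  refine ⟨C, by linarith, ?_⟩
  intro A _ b S hS hb
  have hcard : Fintype.card (Fin b → ZMod 2) = 2 ^ b := by simp [ZMod.card]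
  have h := h A (Fin b → ZMod 2) S.card hS (by rw [hcard]; exact hb) S le_rfl
  have hpos : (0:ℝ) < Fintype.card (Fin c → A → Fin b → ZMod 2) := by
    exact_mod_cast Fintype.card_pos
  have hmax : max 1 ((S.card : ℝ) / 2 ^ b) = (S.card : ℝ) / 2 ^ b := by
    apply max_eq_right
    rw [le_div_iff₀ (by positivity), one_mul]
    exact_mod_cast hb
  unfold tabPr
  rw [Nat.card_eq_fintype_card, Nat.card_eq_fintype_card, Fintype.card_subtype, ge_iff_le,
    le_div_iff₀ hpos]
  have hsplit := card_filter_add_card_filter_not (s := (univ : Finset (Fin c → A → Fin b → ZMod 2)))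
    (fun T => ∃ g, Bad (C * (Real.logb 2 S.card) ^ c) S T g)
  rw [card_univ] at hsplit
  have hsplit' : ((univ.filter fun T : Fin c → A → Fin b → ZMod 2 =>
        ∃ g, Bad (C * (Real.logb 2 S.card) ^ c) S T g).card : ℝ) +
      ((univ.filter fun T : Fin c → A → Fin b → ZMod 2 =>
        ¬ ∃ g, Bad (C * (Real.logb 2 S.card) ^ c) S T g).card : ℝ) =
      Fintype.card (Fin c → A → Fin b → ZMod 2) := by exact_mod_cast hsplit
  have hle : ((univ.filter fun T : Fin c → A → Fin b → ZMod 2 =>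
        ¬ ∃ g, Bad (C * (Real.logb 2 S.card) ^ c) S T g).card : ℝ) ≤
      ((univ.filter fun T : Fin c → A → Fin b → ZMod 2 => ∀ B : Fin b → ZMod 2,
              |((S.filter (fun x => tabHash T x = B)).card : ℝ) -
                  (S.card : ℝ) / 2 ^ b| ≤
                C * Real.sqrt ((S.card : ℝ) / 2 ^ b) * (Real.logb 2 (S.card : ℝ)) ^ c).card : ℝ) := by
    refine Nat.cast_le.2 (card_le_card fun T hT => ?_)
    rw [mem_filter] at hT ⊢
    refine ⟨mem_univ _, fun B => ?_⟩
    have h1 := not_lt.1 (fun h' => hT.2 ⟨B, h'⟩)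
    rw [hcard] at h1
    push_cast at h1
    rw [hmax, mul_right_comm] at h1
    exact h1
  have hm : (Fintype.card (Fin c → A → Fin b → ZMod 2) : ℝ) -
      (S.card : ℝ) ^ (-γ) * Fintype.card (Fin c → A → Fin b → ZMod 2) ≤
      ((univ.filter fun T : Fin c → A → Fin b → ZMod 2 => ∀ B : Fin b → ZMod 2,
              |((S.filter (fun x => tabHash T x = B)).card : ℝ) -
                  (S.card : ℝ) / 2 ^ b| ≤
                C * Real.sqrt ((S.card : ℝ) / 2 ^ b) * (Real.logb 2 (S.card : ℝ)) ^ c).card : ℝ) := by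
    have h' : ((univ.filter fun T : Fin c → A → Fin b → ZMod 2 =>
        ∃ g, Bad (C * (Real.logb 2 S.card) ^ c) S T g).card : ℝ) ≤
        (S.card : ℝ) ^ (-γ) * Fintype.card (Fin c → A → Fin b → ZMod 2) := by
      convert h
    linarith
  rw [sub_mul, one_mul]
  convert hm
end
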